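/- (Two alphabets) Let X = {x_1,…,x_n} and Y = {y_1,…,y_m} be disjoint sets of indeterminates and fix integers 1 ≤ j ≤ n and 1 ≤ k ≤ m. Then the polynomial P_{j,k}(X,Y) = ∏_{S ⊆ [n], |S| = j} ∏_{T ⊆ [m], |T| = k} ( ∑_{i ∈ S} x_i + ∑_{i ∈ T} y_i ) is Schur-positive in the two alphabets: there exist nonnegative integers a_{λμ}, indexed by pairs of partitions (λ, μ) with λ having at most n parts and μ having at most m parts, such that P_{j,k}(X,Y) = ∑_{λ,μ} a_{λμ} · s_λ(x_1,…,x_n) · s_μ(y_1,…,y_m). -/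

import Mathlib

open MvPolynomial

/-- Complete homogeneous symmetric polynomial with integer index: `0` for negative index. -/
noncomputable def hInt (n : ℕ) (m : ℤ) : MvPolynomial (Fin n) ℚ :=
  if 0 ≤ m then hsymm (Fin n) ℚ m.toNat else 0

/-- Schur polynomial via the Jacobi–Trudi determinant. -/
noncomputable def schur (n : ℕ) (lam : Fin n → ℕ) : MvPolynomial (Fin n) ℚ :=
  (Matrix.of fun i j : Fin n => hInt n ((lam i : ℤ) - (i : ℤ) + (j : ℤ))).det

/-- The Schur polynomial `s_λ(x_1,…,x_n)` in the `x`-alphabet of `ℚ[x_1,…,x_n,y_1,…,y_m]`. -/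
noncomputable def schurX (n m : ℕ) (lam : Fin n → ℕ) : MvPolynomial (Fin n ⊕ Fin m) ℚ :=
  rename Sum.inl (schur n lam)

/-- The Schur polynomial `s_μ(y_1,…,y_m)` in the `y`-alphabet of `ℚ[x_1,…,x_n,y_1,…,y_m]`. -/
noncomputable def schurY (n m : ℕ) (mu : Fin m → ℕ) : MvPolynomial (Fin n ⊕ Fin m) ℚ :=
  rename Sum.inr (schur m mu)

/-- The two-alphabet Boolean product polynomial
`P_{j,k}(X,Y) = ∏_{|S|=j} ∏_{|T|=k} (X_S + Y_T)`. -/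
noncomputable def P (n m j k : ℕ) : MvPolynomial (Fin n ⊕ Fin m) ℚ :=
  ∏ S ∈ (Finset.univ : Finset (Fin n)).powersetCard j,
    ∏ T ∈ (Finset.univ : Finset (Fin m)).powersetCard k,
      ((∑ i ∈ S, X (Sum.inl i)) + ∑ i ∈ T, X (Sum.inr i))

/-- The staircase exponent `(n-1, …, 1, 0)`. -/
def staircase (n : ℕ) (i : Fin n) : ℕ := n - 1 - i

/-- The alternant `det (x_j ^ α_i)`. -/
noncomputable def alternant (n : ℕ) (α : Fin n → ℕ) : MvPolynomial (Fin n) ℚ :=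
  (Matrix.of fun i j : Fin n => (X j : MvPolynomial (Fin n) ℚ) ^ α i).det

theorem mk_hsymm_eq_prod (n : ℕ) :
    (PowerSeries.mk fun k => hsymm (Fin n) ℚ k) =
      ∏ i : Fin n, PowerSeries.mk fun k => (X i : MvPolynomial (Fin n) ℚ) ^ k := by
  ext1 k
  rw [PowerSeries.coeff_mk, PowerSeries.coeff_prod, hsymm]
  refine Finset.sum_bij (fun s _ => Multiset.toFinsupp s.1) ?_ ?_ ?_ ?_
  · intro s _
    simp only [Finset.mem_finsuppAntidiag, Finset.subset_univ, and_true]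
    exact (Multiset.sum_count_eq_card fun a _ => Finset.mem_univ a).trans s.2
  · intro s _ t _ h
    exact Subtype.ext (Multiset.toFinsupp.injective h)
  · intro l hl
    refine ⟨⟨Finsupp.toMultiset l, ?_⟩, Finset.mem_univ _, by simp⟩
    simp only [Finset.mem_finsuppAntidiag, Finset.subset_univ, and_true] at hl
    rw [Finsupp.card_toMultiset, Finsupp.sum_fintype _ _ (by simp)]
    exact hl
  · intro s _
    rw [Finset.prod_multiset_map_count]
    simp only [PowerSeries.coeff_mk, Multiset.toFinsupp_apply]
    refine Finset.prod_subset (Finset.subset_univ _) ?_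
    intro i _ hi
    rw [Multiset.mem_toFinset] at hi
    exact (congrArg _ (Multiset.count_eq_zero_of_notMem hi)).trans (pow_zero _)

theorem mk_pow_mul_one_sub {R : Type*} [CommRing R] (a : R) :
    (PowerSeries.mk fun k => a ^ k) * (1 - PowerSeries.C a * PowerSeries.X) = 1 := by
  ext k
  rw [mul_sub, mul_one, ← mul_assoc, map_sub]
  cases k with
  | zero => simp
  | succ k =>
    rw [PowerSeries.coeff_succ_mul_X, PowerSeries.coeff_mul_C]
    simp [PowerSeries.coeff_one, pow_succ]

/-- The polynomial `∏_{i ≠ j} (1 - x_i T)`. -/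
noncomputable def omitProd (n : ℕ) (j : Fin n) : Polynomial (MvPolynomial (Fin n) ℚ) :=
  ∏ i ∈ Finset.univ.erase j, (1 - Polynomial.C (X i) * Polynomial.X)

theorem natDegree_omitProd_lt (n : ℕ) (j : Fin n) : (omitProd n j).natDegree < n := by
  refine lt_of_le_of_lt (Polynomial.natDegree_prod_le _ _) ?_
  refine lt_of_le_of_lt (Finset.sum_le_card_nsmul _ _ 1 ?_) ?_
  · intro i _
    compute_degree
  · have := j.2
    simp
    omega

theorem mk_hsymm_mul_omitProd (n : ℕ) (j : Fin n) :
    (PowerSeries.mk fun k => hsymm (Fin n) ℚ k) * (omitProd n j : PowerSeries _) =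
      PowerSeries.mk fun k => (X j : MvPolynomial (Fin n) ℚ) ^ k := by
  have h : (omitProd n j : PowerSeries (MvPolynomial (Fin n) ℚ)) =
      ∏ i ∈ Finset.univ.erase j, (1 - PowerSeries.C (X i) * PowerSeries.X) := by
    rw [omitProd, ← Polynomial.coeToPowerSeries.ringHom_apply, map_prod]
    simp
  rw [mk_hsymm_eq_prod, h, ← Finset.mul_prod_erase _ _ (Finset.mem_univ j), mul_assoc,
    ← Finset.prod_mul_distrib, Finset.prod_eq_one, mul_one]
  intro i _
  exact mk_pow_mul_one_sub _

theorem sum_hInt_mul_coeff_omitProd (n : ℕ) (j : Fin n) (p : ℕ) :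
    ∑ k ∈ Finset.range n, hInt n ((p : ℤ) - k) * (omitProd n j).coeff k = X j ^ p := by
  have h := congrArg (PowerSeries.coeff p) (mk_hsymm_mul_omitProd n j)
  rw [PowerSeries.coeff_mul, PowerSeries.coeff_mk,
    Finset.Nat.sum_antidiagonal_eq_sum_range_succ_mk, ← Finset.sum_range_reflect] at h
  rw [← h]
  have e1 : ∑ k ∈ Finset.range n, hInt n ((p : ℤ) - k) * (omitProd n j).coeff k =
      ∑ k ∈ Finset.range (max n (p + 1)), hInt n ((p : ℤ) - k) * (omitProd n j).coeff k := by
    refine Finset.sum_subset (by simp) ?_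
    intro k _ hk
    rw [Polynomial.coeff_eq_zero_of_natDegree_lt, mul_zero]
    have := natDegree_omitProd_lt n j
    simp at hk
    omega
  rw [e1]
  symm
  refine Finset.sum_subset_zero_on_sdiff (Finset.range_mono (le_max_right _ _)) ?_ ?_
  · intro k hk
    simp at hk
    rw [hInt, if_neg (by omega), zero_mul]
  · intro k hk
    simp at hk
    have h1 : ((p : ℤ) - k).toNat = p + 1 - 1 - k := by omega
    have h2 : p - (p + 1 - 1 - k) = k := by omega
    rw [hInt, if_pos (by omega), h1, h2]
    simp [PowerSeries.coeff_mk]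

theorem schur_zero (n : ℕ) : schur n 0 = 1 := by
  rw [schur, Matrix.det_of_isUpperTriangular]
  · simp [hInt]
  · intro i j hij
    have : (j : ℕ) < i := hij
    simp only [Matrix.of_apply, hInt]
    rw [if_neg]
    simp
    omega

/-- The bialternant formula. -/
theorem schur_mul_alternant (n : ℕ) (lam : Fin n → ℕ) :
    schur n lam * alternant n (staircase n) = alternant n (lam + staircase n) := by
  set M : Matrix (Fin n) (Fin n) (MvPolynomial (Fin n) ℚ) :=
    Matrix.of fun c j => (omitProd n j).coeff (n - 1 - c) with hM
  have key : ∀ l : Fin n → ℕ, schur n l * M.det = alternant n (l + staircase n) := by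
    intro l
    rw [schur, ← Matrix.det_mul, alternant]
    congr 1
    ext1 i j
    rw [Matrix.mul_apply, Matrix.of_apply, ← sum_hInt_mul_coeff_omitProd,
      ← Finset.sum_range_reflect, ← Fin.sum_univ_eq_sum_range
        (fun k => hInt n (((l + staircase n) i : ℕ) - ((n - 1 - k : ℕ) : ℤ)) *
          (omitProd n j).coeff (n - 1 - k))]
    refine Finset.sum_congr rfl fun c _ => ?_
    simp only [hM, Matrix.of_apply, Pi.add_apply, staircase]
    congr 2
    have := c.2
    have := i.2
    omega
  have h0 := key 0
  rw [schur_zero, one_mul, zero_add] at h0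
  rw [← h0, key]

theorem strictAnti_add_staircase {n : ℕ} {lam : Fin n → ℕ} (h : Antitone lam) :
    StrictAnti (lam + staircase n) := by
  intro i j hij
  have h1 := h hij.le
  have h2 : (i : ℕ) < j := hij
  have := j.2
  simp only [Pi.add_apply, staircase]
  omega

theorem perm_eq_one_of_strictAnti {n : ℕ} {f g : Fin n → ℕ} (hf : StrictAnti f)
    (hg : StrictAnti g) (π : Equiv.Perm (Fin n)) (h : f = g ∘ π) : π = 1 := by
  have hm : StrictMono π := by
    intro i j hij
    have := hf hij
    rw [h] at this
    exact hg.lt_iff_gt.mp this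
  have hle : ∀ i, i ≤ π i := fun i => hm.le_apply
  have hsymm : StrictMono π.symm := fun i j hij => by
    rwa [← hm.lt_iff_lt, π.apply_symm_apply, π.apply_symm_apply]
  refine Equiv.ext fun i => le_antisymm ?_ (hle i)
  have := hsymm.le_apply (x := π i)
  rwa [π.symm_apply_apply] at this

theorem exists_partition_of_injective {n : ℕ} {α : Fin n → ℕ} (hα : Function.Injective α) :
    ∃ (lam : Fin n → ℕ) (σ : Equiv.Perm (Fin n)), Antitone lam ∧ (∀ i, ∃ j, lam i ≤ α j) ∧
      α = (lam + staircase n) ∘ σ := by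
  set s := Tuple.sort (OrderDual.toDual ∘ α) with hs
  have hanti : Antitone (α ∘ s) := fun i j hij => Tuple.monotone_sort (OrderDual.toDual ∘ α) hij
  have hstrict : StrictAnti (α ∘ s) := hanti.strictAnti_of_injective (hα.comp s.injective)
  have hstep : ∀ (d : ℕ) (i j : Fin n), (i : ℕ) + d = j → (α ∘ s) j + d ≤ (α ∘ s) i := by
    intro d
    induction d with
    | zero =>
      intro i j h
      have : i = j := Fin.ext h
      simp [this]
    | succ d ih =>
      intro i j h
      have hlt : (i : ℕ) + d < n := by omega
      have h1 := ih i ⟨i + d, hlt⟩ rfl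
      have h2 : (α ∘ s) j < (α ∘ s) ⟨i + d, hlt⟩ :=
        hstrict (show (⟨i + d, hlt⟩ : Fin n) < j from by rw [Fin.lt_def]; simp; omega)
      omega
  have hge : ∀ i : Fin n, staircase n i ≤ (α ∘ s) i := by
    intro i
    have hi := i.2
    have := hstep (n - 1 - i) i ⟨n - 1, by omega⟩ (by simp; omega)
    simp only [staircase]
    omega
  refine ⟨fun i => (α ∘ s) i - staircase n i, s.symm, ?_, ?_, ?_⟩
  · intro i j hij
    have hij' : (i : ℕ) ≤ j := hij
    have h1 := hstep (j - i) i j (by omega)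
    have h2 := hge i
    have h3 := hge j
    have := i.2
    have := j.2
    simp only [staircase] at *
    omega
  · exact fun i => ⟨s i, Nat.sub_le _ _⟩
  · funext i
    have := hge (s.symm i)
    simp only [Function.comp_apply, Pi.add_apply, Equiv.apply_symm_apply] at *
    omega

/-- The exponent of the monomial `x^α y^β`. -/
noncomputable def pairExp {n m : ℕ} (α : Fin n → ℕ) (β : Fin m → ℕ) : (Fin n ⊕ Fin m) →₀ ℕ :=
  Finsupp.equivFunOnFinite.symm (Sum.elim α β)

theorem pairExp_inj {n m : ℕ} {α α' : Fin n → ℕ} {β β' : Fin m → ℕ} :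
    pairExp α β = pairExp α' β' ↔ α = α' ∧ β = β' := by
  rw [pairExp, pairExp, Equiv.apply_eq_iff_eq, Sum.elim_eq_iff]

theorem exists_eq_pairExp {n m : ℕ} (e : (Fin n ⊕ Fin m) →₀ ℕ) : ∃ α β, e = pairExp α β :=
  ⟨e ∘ Sum.inl, e ∘ Sum.inr, by ext i; cases i <;> simp [pairExp]⟩

theorem monomial_pairExp {n m : ℕ} (α : Fin n → ℕ) (β : Fin m → ℕ) :
    (monomial (pairExp α β) 1 : MvPolynomial (Fin n ⊕ Fin m) ℚ) =
      (∏ i, X (Sum.inl i) ^ α i) * ∏ i, X (Sum.inr i) ^ β i := by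
  rw [monomial_eq, Finsupp.prod_fintype _ _ (by simp)]
  simp [pairExp]

theorem alternant_eq_sum (n : ℕ) (α : Fin n → ℕ) :
    alternant n α = ∑ σ : Equiv.Perm (Fin n), ((σ.sign : ℤ) : MvPolynomial (Fin n) ℚ) *
      ∏ i, X i ^ α (σ i) := by
  rw [alternant, Matrix.det_apply']
  rfl

theorem rename_alternant_mul (n m : ℕ) (α : Fin n → ℕ) (β : Fin m → ℕ) :
    (rename Sum.inl (alternant n α) * rename Sum.inr (alternant m β) :
      MvPolynomial (Fin n ⊕ Fin m) ℚ) =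
    ∑ σ : Equiv.Perm (Fin n), ∑ τ : Equiv.Perm (Fin m),
      monomial (pairExp (α ∘ σ) (β ∘ τ)) (((σ.sign : ℤ) : ℚ) * ((τ.sign : ℤ) : ℚ)) := by
  rw [alternant_eq_sum, alternant_eq_sum, map_sum, map_sum, Finset.sum_mul_sum]
  refine Finset.sum_congr rfl fun σ _ => Finset.sum_congr rfl fun τ _ => ?_
  rw [← mul_one (((σ.sign : ℤ) : ℚ) * _), ← C_mul_monomial, monomial_pairExp]
  simp only [map_mul, map_intCast, map_prod, map_pow, rename_X, Function.comp_apply]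
  ring

/-- Antisymmetry in both alphabets. -/
def IsAlternating {n m : ℕ} (G : MvPolynomial (Fin n ⊕ Fin m) ℚ) : Prop :=
  ∀ (σ : Equiv.Perm (Fin n)) (τ : Equiv.Perm (Fin m)),
    rename (Sum.map σ τ) G = C (((σ.sign : ℤ) : ℚ) * ((τ.sign : ℤ) : ℚ)) * G

theorem IsAlternating.coeff_comp {n m : ℕ} {G : MvPolynomial (Fin n ⊕ Fin m) ℚ}
    (hG : IsAlternating G) (α : Fin n → ℕ) (β : Fin m → ℕ) (σ : Equiv.Perm (Fin n))
    (τ : Equiv.Perm (Fin m)) :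
    coeff (pairExp (α ∘ σ) (β ∘ τ)) G =
      ((σ.sign : ℤ) : ℚ) * ((τ.sign : ℤ) : ℚ) * coeff (pairExp α β) G := by
  have hinj : Function.Injective (Sum.map σ τ) := σ.injective.sumMap τ.injective
  have h := coeff_rename_mapDomain _ hinj G (pairExp (α ∘ σ) (β ∘ τ))
  have hm : Finsupp.mapDomain (Sum.map σ τ) (pairExp (α ∘ σ) (β ∘ τ)) = pairExp α β := by
    ext i
    obtain ⟨j, rfl⟩ : ∃ j, Sum.map σ τ j = i := (σ.surjective.sumMap τ.surjective) i
    rw [Finsupp.mapDomain_apply hinj]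
    cases j <;> simp [pairExp]
  rw [hm, hG σ τ, coeff_C_mul] at h
  exact h.symm

theorem IsAlternating.injective_of_coeff_ne_zero {n m : ℕ} {G : MvPolynomial (Fin n ⊕ Fin m) ℚ}
    (hG : IsAlternating G) {α : Fin n → ℕ} {β : Fin m → ℕ} (h : coeff (pairExp α β) G ≠ 0) :
    Function.Injective α ∧ Function.Injective β := by
  refine ⟨fun i j hij => ?_, fun i j hij => ?_⟩ <;> by_contra hne
  · have := hG.coeff_comp α β (Equiv.swap i j) 1
    rw [Equiv.comp_swap_eq_update, hij, Function.update_eq_self, ← hij,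
      Function.update_eq_self, Equiv.Perm.sign_swap hne] at this
    simp at this
    exact h (by linarith)
  · have := hG.coeff_comp α β 1 (Equiv.swap i j)
    rw [Equiv.comp_swap_eq_update, hij, Function.update_eq_self, ← hij,
      Function.update_eq_self, Equiv.Perm.sign_swap hne] at this
    simp at this
    exact h (by linarith)

/-- Pairs of partitions with at most `n` resp. `m` parts, all parts at most `N`. -/
def partitionBox (n m N : ℕ) : Finset ((Fin n → ℕ) × (Fin m → ℕ)) :=
  open scoped Classical in
  ((Fintype.piFinset fun _ => Finset.range (N + 1)) ×ˢ
    (Fintype.piFinset fun _ => Finset.range (N + 1))).filter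
      fun lm => Antitone lm.1 ∧ Antitone lm.2

theorem mem_partitionBox {n m N : ℕ} {lm : (Fin n → ℕ) × (Fin m → ℕ)} :
    lm ∈ partitionBox n m N ↔
      ((∀ i, lm.1 i ≤ N) ∧ ∀ i, lm.2 i ≤ N) ∧ Antitone lm.1 ∧ Antitone lm.2 := by
  simp [partitionBox]

theorem antitone_pair_unique {n : ℕ} {l l' : Fin n → ℕ} (hl : Antitone l) (hl' : Antitone l')
    {σ σ' : Equiv.Perm (Fin n)}
    (h : (l + staircase n) ∘ σ = (l' + staircase n) ∘ σ') : l = l' ∧ σ = σ' := by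
  have h1 : l + staircase n = (l' + staircase n) ∘ (σ' * σ⁻¹ : Equiv.Perm (Fin n)) := by
    funext i
    simpa using congrFun h (σ⁻¹ i)
  have h2 := perm_eq_one_of_strictAnti (strictAnti_add_staircase hl)
    (strictAnti_add_staircase hl') _ h1
  have h3 : σ = σ' := (mul_inv_eq_one.mp h2).symm
  refine ⟨?_, h3⟩
  rw [h2] at h1
  funext i
  simpa using congrFun h1 i

theorem IsAlternating.eq_sum {n m : ℕ} {G : MvPolynomial (Fin n ⊕ Fin m) ℚ}
    (hG : IsAlternating G) {N : ℕ} (hN : G.totalDegree ≤ N) :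
    G = ∑ lm ∈ partitionBox n m N,
      C (coeff (pairExp (lm.1 + staircase n) (lm.2 + staircase m)) G) *
        (rename Sum.inl (alternant n (lm.1 + staircase n)) *
          rename Sum.inr (alternant m (lm.2 + staircase m))) := by
  ext e
  obtain ⟨α, β, rfl⟩ := exists_eq_pairExp e
  have hterm : ∀ lm : (Fin n → ℕ) × (Fin m → ℕ),
      coeff (pairExp α β) (C (coeff (pairExp (lm.1 + staircase n) (lm.2 + staircase m)) G) *
        (rename Sum.inl (alternant n (lm.1 + staircase n)) *
          rename Sum.inr (alternant m (lm.2 + staircase m)))) =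
      ∑ σ : Equiv.Perm (Fin n), ∑ τ : Equiv.Perm (Fin m),
        if (lm.1 + staircase n) ∘ σ = α ∧ (lm.2 + staircase m) ∘ τ = β then
          coeff (pairExp α β) G else 0 := by
    intro lm
    rw [coeff_C_mul, rename_alternant_mul, coeff_sum, Finset.mul_sum]
    refine Finset.sum_congr rfl fun σ _ => ?_
    rw [coeff_sum, Finset.mul_sum]
    refine Finset.sum_congr rfl fun τ _ => ?_
    rw [coeff_monomial]
    simp only [pairExp_inj]
    split_ifs with h
    · rw [← h.1, ← h.2, hG.coeff_comp]
      ring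
    · simp
  rw [coeff_sum, Finset.sum_congr rfl fun lm _ => hterm lm]
  by_cases h0 : coeff (pairExp α β) G = 0
  · simp [h0]
  obtain ⟨hα, hβ⟩ := hG.injective_of_coeff_ne_zero h0
  have hbound : ∀ i, pairExp α β i ≤ N := fun i =>
    ((Finsupp.le_degree i _).trans (le_totalDegree (mem_support_iff.mpr h0))).trans hN
  obtain ⟨l, σ, hl, hlα, hσ⟩ := exists_partition_of_injective hα
  obtain ⟨u, τ, hu, huβ, hτ⟩ := exists_partition_of_injective hβ
  rw [Finset.sum_eq_single (l, u), Finset.sum_eq_single σ, Finset.sum_eq_single τ,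
    if_pos ⟨hσ.symm, hτ.symm⟩]
  · intro τ' _ hne
    refine if_neg fun h => hne ?_
    exact (antitone_pair_unique hu hu (h.2.trans hτ)).2
  · simp
  · intro σ' _ hne
    refine Finset.sum_eq_zero fun τ' _ => if_neg fun h => hne ?_
    exact (antitone_pair_unique hl hl (h.1.trans hσ)).2
  · simp
  · intro lm hlm hne
    rw [mem_partitionBox] at hlm
    refine Finset.sum_eq_zero fun σ' _ => Finset.sum_eq_zero fun τ' _ => if_neg fun h => hne ?_
    exact Prod.ext (antitone_pair_unique hlm.2.1 hl (h.1.trans hσ)).1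
      (antitone_pair_unique hlm.2.2 hu (h.2.trans hτ)).1
  · intro hnot
    refine absurd (mem_partitionBox.mpr ⟨⟨fun i => ?_, fun i => ?_⟩, hl, hu⟩) hnot
    · obtain ⟨j, hj⟩ := hlα i
      exact hj.trans (hbound (Sum.inl j))
    · obtain ⟨j, hj⟩ := huβ i
      exact hj.trans (hbound (Sum.inr j))

theorem alternant_staircase_ne_zero (n : ℕ) : alternant n (staircase n) ≠ 0 := by
  have hd : alternant n (staircase n) =
      ((Matrix.vandermonde (X : Fin n → MvPolynomial (Fin n) ℚ)).submatrix id Fin.revPerm).det := by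
    rw [alternant, ← Matrix.det_transpose]
    congr 1
    ext1 i j
    simp only [Matrix.transpose_apply, Matrix.of_apply, Matrix.submatrix_apply,
      Matrix.vandermonde_apply, id, Fin.revPerm_apply, Fin.val_rev, staircase]
    congr 1
    omega
  rw [hd, Matrix.det_permute']
  refine mul_ne_zero ?_ (Matrix.det_vandermonde_ne_zero_iff.mpr (X_injective))
  rcases Int.units_eq_one_or (Equiv.Perm.sign (Fin.revPerm : Equiv.Perm (Fin n))) with h | h <;>
    simp [h]

/-- `f` times the two staircase alternants. -/
noncomputable def antisymmetrized {n m : ℕ} (f : MvPolynomial (Fin n ⊕ Fin m) ℚ) :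
    MvPolynomial (Fin n ⊕ Fin m) ℚ :=
  f * (rename Sum.inl (alternant n (staircase n)) * rename Sum.inr (alternant m (staircase m)))

/-- The coefficient of `s_λ(x) s_μ(y)` in the Schur expansion of `f`. -/
noncomputable def schurCoeff {n m : ℕ} (f : MvPolynomial (Fin n ⊕ Fin m) ℚ)
    (lm : (Fin n → ℕ) × (Fin m → ℕ)) : ℚ :=
  coeff (pairExp (lm.1 + staircase n) (lm.2 + staircase m)) (antisymmetrized f)

theorem rename_alternant (n : ℕ) (α : Fin n → ℕ) (σ : Equiv.Perm (Fin n)) :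
    rename σ (alternant n α) = C ((σ.sign : ℤ) : ℚ) * alternant n α := by
  have h : rename σ (alternant n α) =
      ((Matrix.of fun i j : Fin n => (X j : MvPolynomial (Fin n) ℚ) ^ α i).submatrix id σ).det := by
    rw [alternant, AlgHom.map_det]
    congr 1
    ext1 i j
    simp
  rw [h, Matrix.det_permute', alternant]
  simp

theorem isAlternating_antisymmetrized {n m : ℕ} {f : MvPolynomial (Fin n ⊕ Fin m) ℚ}
    (hf : ∀ (σ : Equiv.Perm (Fin n)) (τ : Equiv.Perm (Fin m)), rename (Sum.map σ τ) f = f) :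
    IsAlternating (antisymmetrized f) := by
  intro σ τ
  have hl : Sum.map σ τ ∘ Sum.inl = Sum.inl ∘ σ := rfl
  have hr : Sum.map σ τ ∘ Sum.inr = Sum.inr ∘ τ := rfl
  rw [antisymmetrized, map_mul, hf, map_mul, rename_rename, rename_rename, hl, hr,
    ← rename_rename, ← rename_rename, rename_alternant, rename_alternant]
  simp only [map_mul, rename_C]
  ring

/-- Schur expansion of a polynomial symmetric in both alphabets. -/
theorem eq_sum_schurCoeff {n m : ℕ} {f : MvPolynomial (Fin n ⊕ Fin m) ℚ}
    (hf : ∀ (σ : Equiv.Perm (Fin n)) (τ : Equiv.Perm (Fin m)), rename (Sum.map σ τ) f = f) :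
    f = ∑ lm ∈ partitionBox n m (antisymmetrized f).totalDegree,
      C (schurCoeff f lm) * (schurX n m lm.1 * schurY n m lm.2) := by
  have hne : (rename Sum.inl (alternant n (staircase n)) *
      rename Sum.inr (alternant m (staircase m)) : MvPolynomial (Fin n ⊕ Fin m) ℚ) ≠ 0 := by
    refine mul_ne_zero ?_ ?_
    · exact (map_ne_zero_iff _ (rename_injective _ Sum.inl_injective)).mpr
        (alternant_staircase_ne_zero n)
    · exact (map_ne_zero_iff _ (rename_injective _ Sum.inr_injective)).mpr
        (alternant_staircase_ne_zero m)
  refine mul_right_cancel₀ hne ?_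
  rw [Finset.sum_mul]
  refine ((isAlternating_antisymmetrized hf).eq_sum le_rfl).trans ?_
  refine Finset.sum_congr rfl fun lm _ => ?_
  rw [← schur_mul_alternant, ← schur_mul_alternant, map_mul, map_mul, schurX, schurY, schurCoeff]
  ring

/-- The invariant `∑_w ∏_i A_{w(i), w(σ(i))}` of a square matrix attached to a permutation. -/
def permTrace {ι α R : Type*} [Fintype ι] [DecidableEq ι] [Fintype α] [CommRing R]
    (σ : Equiv.Perm ι) (A : Matrix α α R) : R :=
  ∑ w : ι → α, ∏ i, A (w i) (w (σ i))

section PermTrace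

variable {ι α R : Type*} [Fintype ι] [DecidableEq ι] [Fintype α] [CommRing R]

theorem map_permTrace {S F : Type*} [CommRing S] [FunLike F R S] [RingHomClass F R S] (φ : F)
    (σ : Equiv.Perm ι) (A : Matrix α α R) :
    φ (permTrace σ A) = permTrace σ (A.map φ) := by
  simp [permTrace, map_sum, map_prod]

theorem permTrace_mul {β : Type*} [Fintype β] (σ : Equiv.Perm ι) (B : Matrix α β R)
    (C : Matrix β α R) :
    permTrace σ (B * C) =
      ∑ w : ι → α, ∑ v : ι → β, (∏ i, B (w i) (v i)) * ∏ i, C (v i) (w (σ i)) := by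
  classical
  rw [permTrace]
  refine Finset.sum_congr rfl fun w _ => ?_
  simp only [Matrix.mul_apply]
  rw [Finset.prod_univ_sum, Fintype.piFinset_univ]
  simp only [Finset.prod_mul_distrib]

theorem permTrace_mul_comm {β : Type*} [Fintype β] (σ : Equiv.Perm ι) (B : Matrix α β R)
    (C : Matrix β α R) : permTrace σ (B * C) = permTrace σ (C * B) := by
  rw [permTrace_mul, permTrace_mul, Finset.sum_comm]
  refine Finset.sum_congr rfl fun v _ => ?_
  refine Fintype.sum_equiv (σ.arrowCongr (Equiv.refl α)).symm _ _ fun w => ?_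
  rw [mul_comm]
  congr 1
  rw [← Equiv.prod_comp σ]
  rfl

theorem permTrace_conj [DecidableEq α] (σ : Equiv.Perm ι) {g g' : Matrix α α R} (h : g * g' = 1)
    (A : Matrix α α R) : permTrace σ (g * A * g') = permTrace σ A := by
  rw [permTrace_mul_comm, ← mul_assoc, mul_eq_one_comm.mp h, one_mul]

theorem permTrace_diagonal [DecidableEq α] (σ : Equiv.Perm ι) (x : α → R) :
    permTrace σ (Matrix.diagonal x) = ∑ w : ι → α, if w ∘ σ = w then ∏ i, x (w i) else 0 := by
  refine Finset.sum_congr rfl fun w _ => ?_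
  split_ifs with h
  · refine Finset.prod_congr rfl fun i _ => ?_
    have := congrFun h i
    simp only [Function.comp_apply] at this
    rw [this, Matrix.diagonal_apply_eq]
  · obtain ⟨i, hi⟩ := Function.ne_iff.mp h
    exact Finset.prod_eq_zero (Finset.mem_univ i) (Matrix.diagonal_apply_ne _ (Ne.symm hi))

theorem permTrace_sigma {β : ι → Type*} [∀ i, Fintype (β i)] [∀ i, DecidableEq (β i)]
    (σ : ∀ i, Equiv.Perm (β i)) (A : Matrix α α R) :
    permTrace (Equiv.Perm.sigmaCongrRight σ) A = ∏ i, permTrace (σ i) A := by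
  classical
  simp only [permTrace]
  rw [Finset.prod_univ_sum, Fintype.piFinset_univ]
  refine Fintype.sum_equiv (Equiv.piCurry fun _ _ => α) _ _ fun w => ?_
  rw [Fintype.prod_sigma]
  rfl

end PermTrace

section HMatrix

variable {R : Type*} [CommRing R] [Algebra ℚ R]

/-- The complete homogeneous symmetric function of the eigenvalues of a matrix. -/
noncomputable def hMatrix {α : Type*} [Fintype α] (k : ℕ) (A : Matrix α α R) : R :=
  ((k.factorial : ℚ)⁻¹) • ∑ σ : Equiv.Perm (Fin k), permTrace σ A

/-- `hMatrix` with an integer index. -/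
noncomputable def hMatrixInt {α : Type*} [Fintype α] (k : ℤ) (A : Matrix α α R) : R :=
  if 0 ≤ k then hMatrix k.toNat A else 0

/-- The Schur function of the eigenvalues of a matrix. -/
noncomputable def schurMatrix {n : ℕ} (nu : Fin n → ℕ) (A : Matrix (Fin n) (Fin n) R) : R :=
  (Matrix.of fun i j : Fin n => hMatrixInt ((nu i : ℤ) - (i : ℤ) + (j : ℤ)) A).det

theorem exists_perm_of_map_univ_eq {ι α : Type*} [Fintype ι] [DecidableEq ι] [DecidableEq α]
    {w w₀ : ι → α}
    (h : Multiset.map w Finset.univ.val = Multiset.map w₀ Finset.univ.val) :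
    ∃ ρ : Equiv.Perm ι, w = w₀ ∘ ρ := by
  have e : ∀ a, Nonempty ({i // w i = a} ≃ {i // w₀ i = a}) := by
    intro a
    refine ⟨Fintype.equivOfCardEq ?_⟩
    have := congrArg (Multiset.count a) h
    rw [Multiset.count_map, Multiset.count_map] at this
    rw [Fintype.card_subtype, Fintype.card_subtype, Finset.card_def, Finset.card_def]
    simpa only [Finset.filter_val, eq_comm] using this
  exact ⟨Equiv.ofFiberEquiv fun a => (e a).some,
    funext fun i => (Equiv.ofFiberEquiv_map (fun a => (e a).some) i).symm⟩

theorem sum_stabilizer_eq_hsymm {n k : ℕ} (x : Fin n → R) :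
    ∑ σ : Equiv.Perm (Fin k), permTrace σ (Matrix.diagonal x) =
      (k.factorial : R) * aeval x (hsymm (Fin n) ℚ k) := by
  classical
  simp only [permTrace_diagonal]
  rw [Finset.sum_comm, hsymm, map_sum, Finset.mul_sum]
  let toSym : (Fin k → Fin n) → Sym (Fin n) k :=
    fun w => ⟨Multiset.map w Finset.univ.val, by simp⟩
  rw [← Finset.sum_fiberwise_of_maps_to (g := toSym) (fun w _ => Finset.mem_univ _)]
  refine Finset.sum_congr rfl fun s _ => ?_
  obtain ⟨w₀, hw₀⟩ : ∃ w₀, toSym w₀ = s := by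
    obtain ⟨s, hs⟩ := s
    induction s using Quotient.inductionOn with
    | _ l =>
      subst hs
      refine ⟨l.get, Subtype.ext ?_⟩
      exact (Fin.univ_val_map l.get).trans (congrArg _ (List.ofFn_get l))
  have hval : ∀ w, toSym w = s → ∏ i, x (w i) =
      aeval x ((s.1.map X).prod : MvPolynomial (Fin n) ℚ) := by
    rintro w rfl
    simp only [toSym, Multiset.map_map]
    rw [map_multiset_prod, Multiset.map_map]
    simp [Finset.prod, Function.comp_def]
  have hterm : ∀ w ∈ Finset.univ.filter (fun w => toSym w = s),
      (∑ σ : Equiv.Perm (Fin k), if w ∘ σ = w then ∏ i, x (w i) else 0) =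
      ∑ σ : Equiv.Perm (Fin k), if w₀ ∘ σ = w then
        aeval x ((s.1.map X).prod : MvPolynomial (Fin n) ℚ) else 0 := by
    intro w hw
    rw [Finset.mem_filter] at hw
    obtain ⟨ρ, hρ⟩ := exists_perm_of_map_univ_eq (w := w) (w₀ := w₀)
      (congrArg Subtype.val (hw.2.trans hw₀.symm))
    rw [hval w hw.2]
    refine Fintype.sum_equiv (Equiv.mulLeft ρ) _ _ fun σ => ?_
    refine if_congr ?_ rfl rfl
    rw [Equiv.coe_mulLeft, Equiv.Perm.coe_mul, ← Function.comp_assoc, ← hρ]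
  rw [Finset.sum_congr rfl hterm, Finset.sum_comm]
  have hone : ∀ σ : Equiv.Perm (Fin k), (∑ w ∈ Finset.univ.filter (fun w => toSym w = s),
      if w₀ ∘ σ = w then aeval x ((s.1.map X).prod : MvPolynomial (Fin n) ℚ) else 0) =
      aeval x ((s.1.map X).prod : MvPolynomial (Fin n) ℚ) := by
    intro σ
    rw [Finset.sum_ite_eq, if_pos]
    rw [Finset.mem_filter]
    refine ⟨Finset.mem_univ _, ?_⟩
    rw [← hw₀]
    refine Subtype.ext ?_
    simp only [toSym]
    rw [← Multiset.map_map]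
    congr 1
    exact congrArg Finset.val (Finset.map_univ_equiv σ)
  rw [Finset.sum_congr rfl fun σ _ => hone σ]
  simp [Fintype.card_perm, Finset.sum_const]

theorem hMatrixInt_conj_diagonal {n : ℕ} (k : ℤ) {g g' : Matrix (Fin n) (Fin n) R}
    (h : g * g' = 1) (x : Fin n → R) :
    hMatrixInt k (g * Matrix.diagonal x * g') = aeval x (hInt n k) := by
  rw [hMatrixInt, hInt]
  split_ifs
  · rw [hMatrix, Finset.sum_congr rfl fun σ _ => permTrace_conj σ h _, sum_stabilizer_eq_hsymm,
      ← nsmul_eq_mul, ← Nat.cast_smul_eq_nsmul ℚ, smul_smul, inv_mul_cancel₀, one_smul]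
    exact_mod_cast Nat.factorial_ne_zero _
  · simp

theorem schurMatrix_conj_diagonal {n : ℕ} (nu : Fin n → ℕ) {g g' : Matrix (Fin n) (Fin n) R}
    (h : g * g' = 1) (x : Fin n → R) :
    schurMatrix nu (g * Matrix.diagonal x * g') = aeval x (schur n nu) := by
  rw [schurMatrix, schur, AlgHom.map_det]
  congr 1
  ext1 i j
  simp [hMatrixInt_conj_diagonal _ h]

theorem map_schurMatrix {S : Type*} [CommRing S] [Algebra ℚ S] (φ : R →ₐ[ℚ] S) {n : ℕ}
    (nu : Fin n → ℕ) (A : Matrix (Fin n) (Fin n) R) :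
    φ (schurMatrix nu A) = schurMatrix nu (A.map φ) := by
  rw [schurMatrix, schurMatrix, AlgHom.map_det]
  congr 1
  ext1 i j
  simp only [AlgHom.mapMatrix_apply, Matrix.map_apply, Matrix.of_apply, hMatrixInt]
  split_ifs
  · simp only [hMatrix, map_smul, map_sum, map_permTrace]
  · simp

end HMatrix

theorem exists_diagonalization_of_isHermitian {n : ℕ} {H : Matrix (Fin n) (Fin n) ℂ}
    (hH : H.IsHermitian) : ∃ (g g' : Matrix (Fin n) (Fin n) ℂ) (x : Fin n → ℂ),
      g * g' = 1 ∧ H = g * Matrix.diagonal x * g' := by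
  refine ⟨hH.eigenvectorUnitary, star (hH.eigenvectorUnitary : Matrix (Fin n) (Fin n) ℂ),
    RCLike.ofReal ∘ hH.eigenvalues, Unitary.coe_mul_star_self _, ?_⟩
  exact hH.spectral_theorem

/-- A natural function of two matrices which vanishes on diagonalizable complex matrices
vanishes on rational matrices. -/
theorem eq_zero_of_diagonalizable {n m : ℕ}
    (F : ∀ (R : Type) [CommRing R] [Algebra ℚ R],
      Matrix (Fin n) (Fin n) R → Matrix (Fin m) (Fin m) R → R)
    (hF : ∀ (R S : Type) [CommRing R] [Algebra ℚ R] [CommRing S] [Algebra ℚ S] (φ : R →ₐ[ℚ] S)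
      (A : Matrix (Fin n) (Fin n) R) (B : Matrix (Fin m) (Fin m) R),
      φ (F R A B) = F S (A.map φ) (B.map φ))
    (h0 : ∀ (g g' : Matrix (Fin n) (Fin n) ℂ) (x : Fin n → ℂ) (h h' : Matrix (Fin m) (Fin m) ℂ)
      (y : Fin m → ℂ), g * g' = 1 → h * h' = 1 →
      F ℂ (g * Matrix.diagonal x * g') (h * Matrix.diagonal y * h') = 0)
    (A : Matrix (Fin n) (Fin n) ℚ) (B : Matrix (Fin m) (Fin m) ℚ) : F ℚ A B = 0 := by
  have hdecomp : ∀ {k : ℕ} (A : Matrix (Fin k) (Fin k) ℂ), ∃ H K : Matrix (Fin k) (Fin k) ℂ,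
      H.IsHermitian ∧ K.IsHermitian ∧ A = H + Complex.I • K := by
    intro k A
    refine ⟨(1 / 2 : ℝ) • (A + A.conjTranspose),
      (1 / 2 : ℝ) • (-Complex.I • (A - A.conjTranspose)), ?_, ?_, ?_⟩
    · rw [Matrix.IsHermitian, Matrix.conjTranspose_smul, Matrix.conjTranspose_add,
        Matrix.conjTranspose_conjTranspose, add_comm]
      simp
    · rw [Matrix.IsHermitian, Matrix.conjTranspose_smul, Matrix.conjTranspose_smul,
        Matrix.conjTranspose_sub, Matrix.conjTranspose_conjTranspose]
      congr 1
      simp only [star_neg, RCLike.star_def, Complex.conj_I, neg_neg, smul_sub, neg_smul]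
      abel
    · ext i j
      simp only [Matrix.add_apply, Matrix.smul_apply, Matrix.sub_apply, Complex.real_smul,
        smul_eq_mul]
      push_cast
      ring_nf
      rw [Complex.I_sq]
      ring
  have hreal : ∀ {k : ℕ} {H K : Matrix (Fin k) (Fin k) ℂ} (_ : H.IsHermitian)
      (_ : K.IsHermitian) (t : ℝ), (H + (t : ℂ) • K).IsHermitian := by
    intro k H K hH hK t
    refine hH.add ?_
    rw [Matrix.IsHermitian, Matrix.conjTranspose_smul, hK]
    simp
  have hcomplex : ∀ (A : Matrix (Fin n) (Fin n) ℂ) (B : Matrix (Fin m) (Fin m) ℂ),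
      F ℂ A B = 0 := by
    intro A B
    obtain ⟨H, K, hH, hK, rfl⟩ := hdecomp A
    obtain ⟨H', K', hH', hK', rfl⟩ := hdecomp B
    let ev (t : ℂ) : Polynomial ℂ →ₐ[ℚ] ℂ := (Polynomial.aeval t).restrictScalars ℚ
    let line {k : ℕ} (H K : Matrix (Fin k) (Fin k) ℂ) : Matrix (Fin k) (Fin k) (Polynomial ℂ) :=
      Matrix.of fun i j => Polynomial.C (H i j) + Polynomial.X * Polynomial.C (K i j)
    have hline : ∀ {k : ℕ} (H K : Matrix (Fin k) (Fin k) ℂ) (t : ℂ),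
        (line H K).map (ev t) = H + t • K := by
      intro k H K t
      ext i j
      simp [line, ev]
      ring
    have hev : ∀ t, ev t (F _ (line H K) (line H' K')) = F ℂ (H + t • K) (H' + t • K') := by
      intro t
      rw [hF, hline, hline]
    have hzero : F _ (line H K) (line H' K') = 0 := by
      refine Polynomial.eq_zero_of_infinite_isRoot _ ?_
      refine (Set.infinite_range_of_injective Complex.ofReal_injective).mono ?_
      rintro _ ⟨t, rfl⟩
      have h := hev t
      obtain ⟨g, g', x, hg, hx⟩ := exists_diagonalization_of_isHermitian (hreal hH hK t)
      obtain ⟨h₁, h₁', y, hh, hy⟩ := exists_diagonalization_of_isHermitian (hreal hH' hK' t)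
      rw [hx, hy, h0 _ _ _ _ _ _ hg hh] at h
      simpa [ev, Polynomial.IsRoot, Polynomial.aeval_def, Polynomial.eval₂_eq_eval_map] using h
    rw [← hev, hzero, map_zero]
  have h := hF ℚ ℂ (Algebra.ofId ℚ ℂ) A B
  rw [hcomplex] at h
  exact (map_eq_zero_iff _ (algebraMap ℚ ℂ).injective).mp h

section Compound

set_option linter.unusedSectionVars false

open Matrix

variable {n j : ℕ} {R : Type*} [CommRing R] [Algebra ℚ R]

/-- The `j`-element subsets of `Fin n`. -/
abbrev Subsets (n j : ℕ) : Type := {S : Finset (Fin n) // S.card = j}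

/-- The increasing enumeration of a `j`-element subset. -/
def Subsets.word (S : Subsets n j) : Fin j → Fin n := S.1.orderEmbOfFin S.2

theorem Subsets.word_injective (S : Subsets n j) : Function.Injective S.word :=
  (S.1.orderEmbOfFin S.2).injective

theorem Subsets.range_word (S : Subsets n j) : Set.range S.word = S.1 :=
  Finset.range_orderEmbOfFin S.1 S.2

theorem Subsets.word_comp_eq {S S' : Subsets n j} {π : Equiv.Perm (Fin j)}
    (h : S.word = S'.word ∘ π) : S = S' ∧ π = 1 := by
  have h1 : S = S' := by
    refine Subtype.ext (Finset.coe_injective ?_)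
    rw [← S.range_word, ← S'.range_word, h, π.surjective.range_comp]
  refine ⟨h1, Equiv.ext fun i => ?_⟩
  subst h1
  exact (S.word_injective (congrFun h i)).symm

theorem exists_word_comp_eq {w : Fin j → Fin n} (hw : Function.Injective w) :
    ∃ (S : Subsets n j) (π : Equiv.Perm (Fin j)), w = S.word ∘ π := by
  let S : Subsets n j := ⟨Finset.univ.image w, by simp [Finset.card_image_of_injective _ hw]⟩
  have hmem : ∀ i, w i ∈ Set.range S.word := by
    intro i
    rw [S.range_word]
    simp [S]
  choose π hπ using hmem
  have hinj : Function.Injective π := fun a b hab => hw (by rw [← hπ a, ← hπ b, hab])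
  exact ⟨S, Equiv.ofBijective π (Finite.injective_iff_bijective.mp hinj),
    funext fun i => (hπ i).symm⟩

/-- Antisymmetric functions on words. -/
def AntisymmOnWords (f : (Fin j → Fin n) → R) : Prop :=
  ∀ (w : Fin j → Fin n) (π : Equiv.Perm (Fin j)), f (w ∘ π) = ((π.sign : ℤ) : R) * f w

theorem AntisymmOnWords.eq_zero {f : (Fin j → Fin n) → R} (hf : AntisymmOnWords f)
    {w : Fin j → Fin n}
    (hw : ¬ Function.Injective w) : f w = 0 := by
  simp only [Function.Injective, not_forall] at hw
  obtain ⟨a, b, hab, hne⟩ := hw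
  have h := hf w (Equiv.swap a b)
  rw [Equiv.comp_swap_eq_update, hab, Function.update_eq_self, ← hab, Function.update_eq_self,
    Equiv.Perm.sign_swap hne] at h
  have h2 : (2 : ℚ) • f w = 0 := by
    rw [two_smul]
    nth_rewrite 1 [h]
    simp
  rw [← one_smul ℚ (f w), ← inv_mul_cancel₀ (two_ne_zero (α := ℚ)), mul_smul, h2, smul_zero]

variable (n j R) in
/-- The antisymmetrization matrix from `j`-subsets to words of length `j`. -/
def wedge : Matrix (Fin j → Fin n) (Subsets n j) R :=
  of fun w S => ∑ π : Equiv.Perm (Fin j), if w = S.word ∘ π then ((π.sign : ℤ) : R) else 0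

theorem wedge_isAntisymm (S : Subsets n j) : AntisymmOnWords fun w => wedge n j R w S := by
  intro w ρ
  simp only [wedge, of_apply, Finset.mul_sum]
  refine Fintype.sum_equiv (Equiv.mulRight ρ⁻¹) _ _ fun π => ?_
  have hiff : w ∘ ρ = S.word ∘ π ↔ w = S.word ∘ (π * ρ⁻¹ : Equiv.Perm (Fin j)) := by
    constructor
    · intro h
      funext i
      simpa using congrFun h (ρ⁻¹ i)
    · intro h
      funext i
      simpa using congrFun h (ρ i)
  rw [mul_ite, mul_zero]
  refine if_congr hiff ?_ rfl
  rw [Equiv.coe_mulRight, map_mul, map_inv]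
  push_cast
  rcases Int.units_eq_one_or ρ.sign with h | h <;> simp [h]

theorem wedge_word (S S' : Subsets n j) :
    wedge n j R S.word S' = if S = S' then 1 else 0 := by
  simp only [wedge, of_apply]
  split_ifs with h
  · subst h
    rw [Finset.sum_eq_single 1]
    · simp
    · intro π _ hπ
      exact if_neg fun h => hπ (Subsets.word_comp_eq h).2
    · simp
  · exact Finset.sum_eq_zero fun π _ => if_neg fun h' => h (Subsets.word_comp_eq h').1

theorem wedge_eq_zero {w : Fin j → Fin n} (hw : ¬ Function.Injective w) (S : Subsets n j) :
    wedge n j R w S = 0 :=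
  (wedge_isAntisymm S).eq_zero hw

theorem sum_wedge_mul {f : (Fin j → Fin n) → R} (hf : AntisymmOnWords f) (S : Subsets n j) :
    ∑ w, wedge n j R w S * f w = (j.factorial : R) * f S.word := by
  simp only [wedge, of_apply, Finset.sum_mul]
  rw [Finset.sum_comm]
  have : ∀ π : Equiv.Perm (Fin j),
      (∑ w, (if w = S.word ∘ π then ((π.sign : ℤ) : R) else 0) * f w) = f S.word := by
    intro π
    simp only [ite_mul, zero_mul, Finset.sum_ite_eq', Finset.mem_univ, if_true]
    rw [hf, ← mul_assoc, ← Int.cast_mul, ← Units.val_mul, Int.units_mul_self]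
    simp
  rw [Finset.sum_congr rfl fun π _ => this π]
  simp [Fintype.card_perm]

theorem wedge_transpose_mul_wedge :
    (wedge n j R)ᵀ * wedge n j R = (j.factorial : R) • 1 := by
  ext S S'
  rw [mul_apply]
  simp only [transpose_apply]
  rw [sum_wedge_mul (wedge_isAntisymm S'), wedge_word, Matrix.smul_apply, one_apply, smul_eq_mul]

theorem wedge_mul_transpose_mul {β : Type*} {M : Matrix (Fin j → Fin n) β R}
    (hM : ∀ b, AntisymmOnWords fun w => M w b) :
    wedge n j R * ((wedge n j R)ᵀ * M) = (j.factorial : R) • M := by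
  ext w b
  rw [mul_apply]
  simp only [mul_apply, transpose_apply]
  simp only [sum_wedge_mul (hM b), Matrix.smul_apply, smul_eq_mul]
  by_cases hw : Function.Injective w
  · obtain ⟨S, π, rfl⟩ := exists_word_comp_eq hw
    have h1 : ∀ S', wedge n j R (S.word ∘ π) S' =
        ((π.sign : ℤ) : R) * (if S = S' then 1 else 0) := by
      intro S'
      rw [← wedge_word]
      exact wedge_isAntisymm S' S.word π
    simp only [h1]
    have := hM b S.word π
    simp only at this
    rw [this]
    simp [mul_left_comm]
  · have := (hM b).eq_zero hw
    rw [this]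
    simp [wedge_eq_zero hw]

/-- The Kronecker product of a family of matrices. -/
def tensorMatrix (M : Fin j → Matrix (Fin n) (Fin n) R) :
    Matrix (Fin j → Fin n) (Fin j → Fin n) R :=
  of fun w w' => ∏ i, M i (w i) (w' i)

theorem tensorMatrix_mul (M N : Fin j → Matrix (Fin n) (Fin n) R) :
    tensorMatrix M * tensorMatrix N = tensorMatrix (M * N) := by
  ext w w'
  simp only [tensorMatrix, mul_apply, of_apply, Pi.mul_apply]
  rw [Finset.prod_univ_sum, Fintype.piFinset_univ]
  simp only [Finset.prod_mul_distrib]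

theorem tensorMatrix_one : tensorMatrix (1 : Fin j → Matrix (Fin n) (Fin n) R) = 1 := by
  ext w w'
  simp only [tensorMatrix, of_apply, Pi.one_apply, one_apply, Finset.prod_ite_zero]
  simp [funext_iff]

theorem transpose_tensorMatrix (M : Fin j → Matrix (Fin n) (Fin n) R) :
    (tensorMatrix M)ᵀ = tensorMatrix fun i => (M i)ᵀ := rfl

theorem tensorMatrix_mul_wedge_isAntisymm (g : Matrix (Fin n) (Fin n) R) (S : Subsets n j) :
    AntisymmOnWords fun w => (tensorMatrix (fun _ : Fin j => g) * wedge n j R) w S := by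
  intro w π
  simp only [mul_apply, Finset.mul_sum]
  refine Fintype.sum_equiv (π.arrowCongr (Equiv.refl _)) _ _ fun v => ?_
  have h1 := wedge_isAntisymm (R := R) S v π⁻¹
  have h2 : (π.arrowCongr (Equiv.refl (Fin n))) v = v ∘ (π⁻¹ : Equiv.Perm (Fin j)) := rfl
  simp only at h1
  rw [h2, h1, mul_left_comm, ← mul_assoc ((_ : ℤ) : R), ← Int.cast_mul, ← Units.val_mul,
    Equiv.Perm.sign_inv, Int.units_mul_self]
  simp only [tensorMatrix, of_apply, Units.val_one, Int.cast_one, one_mul]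
  congr 1
  rw [← Equiv.prod_comp π fun i => g (w i) ((v ∘ (π⁻¹ : Equiv.Perm (Fin j))) i)]
  simp

variable (j) in
/-- The `j`-th compound of a matrix. -/
noncomputable def compound (g : Matrix (Fin n) (Fin n) R) : Matrix (Subsets n j) (Subsets n j) R :=
  ((j.factorial : ℚ)⁻¹) • ((wedge n j R)ᵀ * tensorMatrix (fun _ : Fin j => g) * wedge n j R)

/-- The action of a matrix as a derivation on words. -/
def derivWords (A : Matrix (Fin n) (Fin n) R) : Matrix (Fin j → Fin n) (Fin j → Fin n) R :=
  ∑ p : Fin j, tensorMatrix (Function.update 1 p A)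

variable (j) in
/-- The `j`-th additive compound of a matrix. -/
noncomputable def addCompound (A : Matrix (Fin n) (Fin n) R) :
    Matrix (Subsets n j) (Subsets n j) R :=
  ((j.factorial : ℚ)⁻¹) • ((wedge n j R)ᵀ * derivWords (j := j) A * wedge n j R)

theorem derivWords_conj {g g' : Matrix (Fin n) (Fin n) R} (h : g * g' = 1)
    (A : Matrix (Fin n) (Fin n) R) :
    derivWords (j := j) (g * A * g') =
      tensorMatrix (fun _ : Fin j => g) * derivWords (j := j) A *
        tensorMatrix (fun _ : Fin j => g') := by
  simp only [derivWords, Finset.mul_sum, Finset.sum_mul, tensorMatrix_mul]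
  refine Finset.sum_congr rfl fun p _ => ?_
  congr 1
  funext i
  by_cases hi : i = p
  · subst hi
    simp
  · simp [Function.update_of_ne hi, h]

theorem factorial_inv_smul_smul {β γ : Type*} (M : Matrix β γ R) :
    ((j.factorial : ℚ)⁻¹) • ((j.factorial : R) • M) = M := by
  rw [Nat.cast_smul_eq_nsmul, ← Nat.cast_smul_eq_nsmul ℚ, smul_smul, inv_mul_cancel₀, one_smul]
  exact_mod_cast Nat.factorial_ne_zero _

theorem wedge_mul_wedge_transpose_tensorMatrix_wedge (g : Matrix (Fin n) (Fin n) R) :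
    wedge n j R * compound j g = tensorMatrix (fun _ : Fin j => g) * wedge n j R := by
  rw [compound, Matrix.mul_smul, Matrix.mul_assoc,
    wedge_mul_transpose_mul (tensorMatrix_mul_wedge_isAntisymm g), factorial_inv_smul_smul]

theorem compound_transpose (g : Matrix (Fin n) (Fin n) R) :
    (compound j g : Matrix (Subsets n j) (Subsets n j) R)ᵀ = compound j gᵀ := by
  simp only [compound, transpose_smul, transpose_mul, transpose_tensorMatrix, transpose_transpose,
    Matrix.mul_assoc]

theorem compound_mul_wedge_transpose (g : Matrix (Fin n) (Fin n) R) :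
    compound j g * (wedge n j R)ᵀ = (wedge n j R)ᵀ * tensorMatrix (fun _ : Fin j => g) := by
  have h := congrArg transpose (wedge_mul_wedge_transpose_tensorMatrix_wedge (j := j) gᵀ)
  rw [transpose_mul, transpose_mul, compound_transpose, transpose_tensorMatrix] at h
  simpa using h

theorem compound_mul_compound {g g' : Matrix (Fin n) (Fin n) R} (h : g * g' = 1) :
    compound j g * compound j g' = (1 : Matrix (Subsets n j) (Subsets n j) R) := by
  nth_rewrite 2 [compound]
  rw [Matrix.mul_smul, Matrix.mul_assoc, ← Matrix.mul_assoc, compound_mul_wedge_transpose,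
    Matrix.mul_assoc, ← Matrix.mul_assoc (tensorMatrix _) (tensorMatrix _), tensorMatrix_mul]
  have : ((fun _ => g) * (fun _ => g') : Fin j → Matrix (Fin n) (Fin n) R) = 1 := by
    funext i
    simp [h]
  rw [this, tensorMatrix_one, Matrix.one_mul, wedge_transpose_mul_wedge, factorial_inv_smul_smul]

theorem addCompound_conj {g g' : Matrix (Fin n) (Fin n) R} (h : g * g' = 1)
    (A : Matrix (Fin n) (Fin n) R) :
    addCompound j (g * A * g') = compound j g * addCompound j A * compound j g' := by
  rw [addCompound, addCompound, derivWords_conj h, Matrix.mul_smul, Matrix.smul_mul]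
  congr 1
  rw [Matrix.mul_assoc _ _ (compound j g'), Matrix.mul_assoc _ _ (compound j g'),
    wedge_mul_wedge_transpose_tensorMatrix_wedge, Matrix.mul_assoc (wedge n j R)ᵀ,
    ← Matrix.mul_assoc (compound j g), ← Matrix.mul_assoc (compound j g),
    compound_mul_wedge_transpose]
  simp only [Matrix.mul_assoc]

theorem addCompound_diagonal (x : Fin n → R) :
    addCompound j (diagonal x) = diagonal fun S : Subsets n j => ∑ i ∈ S.1, x i := by
  have hderiv : derivWords (j := j) (diagonal x) = diagonal fun w => ∑ p, x (w p) := by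
    ext w w'
    rw [derivWords, Matrix.sum_apply]
    by_cases hw : w = w'
    · subst hw
      rw [diagonal_apply_eq]
      refine Finset.sum_congr rfl fun p _ => ?_
      simp only [tensorMatrix, of_apply]
      rw [Finset.prod_eq_single p]
      · simp
      · intro i _ hi
        simp [Function.update_of_ne hi]
      · simp
    · rw [diagonal_apply_ne _ hw]
      refine Finset.sum_eq_zero fun p _ => ?_
      obtain ⟨i, hi⟩ := Function.ne_iff.mp hw
      refine Finset.prod_eq_zero (Finset.mem_univ i) ?_
      by_cases hip : i = p
      · subst hip
        simp [hi]
      · simp [Function.update_of_ne hip, hi]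
  have hanti : ∀ S : Subsets n j,
      AntisymmOnWords fun w =>
        (diagonal (fun w : Fin j → Fin n => ∑ p, x (w p)) * wedge n j R) w S := by
    intro S w π
    simp only [diagonal_mul, Function.comp_apply]
    rw [Equiv.sum_comp π fun p => x (w p)]
    have := wedge_isAntisymm (R := R) S w π
    simp only at this
    rw [this]
    ring
  rw [addCompound, hderiv]
  have : (wedge n j R)ᵀ * diagonal (fun w : Fin j → Fin n => ∑ p, x (w p)) * wedge n j R =
      (j.factorial : R) • diagonal fun S : Subsets n j => ∑ i ∈ S.1, x i := by
    ext S S'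
    rw [Matrix.mul_assoc, mul_apply]
    simp only [transpose_apply]
    rw [sum_wedge_mul (hanti S'), diagonal_mul, wedge_word, Matrix.smul_apply, smul_eq_mul,
      diagonal_apply]
    split_ifs with h
    · rw [mul_one]
      congr 1
      have himg : S.1 = Finset.univ.image S.word := by
        rw [← Finset.coe_inj, ← S.range_word]
        simp
      conv_rhs => rw [himg]
      rw [Finset.sum_image fun a _ b _ hab => S.word_injective hab]
    · simp
  rw [this, factorial_inv_smul_smul]

end Compound

section MixedCompound

open Matrix Kronecker

variable {n m : ℕ} {R : Type*} [CommRing R] [Algebra ℚ R]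

/-- The matrix acting on `Λ^j ⊗ Λ^k` by the sum of two derivations. -/
noncomputable def mixedCompound (j k : ℕ) (A : Matrix (Fin n) (Fin n) R)
    (B : Matrix (Fin m) (Fin m) R) :
    Matrix (Subsets n j × Subsets m k) (Subsets n j × Subsets m k) R :=
  addCompound j A ⊗ₖ 1 + 1 ⊗ₖ addCompound k B

theorem det_mixedCompound_conj_diagonal (j k : ℕ) {g g' : Matrix (Fin n) (Fin n) R}
    {h h' : Matrix (Fin m) (Fin m) R} (hg : g * g' = 1) (hh : h * h' = 1) (x : Fin n → R)
    (y : Fin m → R) :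
    (mixedCompound j k (g * diagonal x * g') (h * diagonal y * h')).det =
      aeval (Sum.elim x y) (P n m j k) := by
  have hc := compound_mul_compound (j := j) hg
  have hd := compound_mul_compound (j := k) hh
  have hconj : mixedCompound j k (g * diagonal x * g') (h * diagonal y * h') =
      (compound j g ⊗ₖ compound k h) * mixedCompound j k (diagonal x) (diagonal y) *
        (compound j g' ⊗ₖ compound k h') := by
    simp only [mixedCompound, Matrix.mul_add, Matrix.add_mul, ← mul_kronecker_mul,
      addCompound_conj hg, addCompound_conj hh, Matrix.mul_one, hc, hd]
  have hone : (compound j g ⊗ₖ compound k h) * (compound j g' ⊗ₖ compound k h') = 1 := by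
    rw [← mul_kronecker_mul, hc, hd, one_kronecker_one]
  have hdiag : mixedCompound j k (diagonal x) (diagonal y) =
      diagonal fun ST : Subsets n j × Subsets m k => ∑ i ∈ ST.1.1, x i + ∑ i ∈ ST.2.1, y i := by
    rw [mixedCompound, addCompound_diagonal, addCompound_diagonal, ← diagonal_one, ← diagonal_one,
      diagonal_kronecker_diagonal, diagonal_kronecker_diagonal, diagonal_add]
    simp
  rw [hconj, det_mul_right_comm, hone, Matrix.one_mul, hdiag, det_diagonal, P, map_prod,
    Fintype.prod_prod_type, Finset.prod_subtype _ (p := fun S : Finset (Fin n) => S.card = j)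
      (fun S => by simp [Finset.mem_powersetCard])]
  refine Finset.prod_congr rfl fun S _ => ?_
  rw [map_prod]
  refine Eq.trans ?_ (Finset.prod_subtype (p := fun T : Finset (Fin m) => T.card = k)
    (F := (inferInstance : Fintype (Subsets m k))) (Finset.univ.powersetCard k)
    (fun S => by simp [Finset.mem_powersetCard]) _).symm
  simp

theorem map_addCompound {S : Type*} [CommRing S] [Algebra ℚ S] (φ : R →ₐ[ℚ] S) (j : ℕ)
    (A : Matrix (Fin n) (Fin n) R) :
    (addCompound j A).map φ = addCompound j (A.map φ) := by
  have hw : (wedge n j R).map φ = wedge n j S := by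
    ext w T
    simp only [wedge, map_apply, of_apply, map_sum]
    refine Finset.sum_congr rfl fun π _ => ?_
    split_ifs <;> simp
  have hd : (derivWords (j := j) A).map φ = derivWords (A.map φ) := by
    ext w w'
    simp only [derivWords, map_apply, Matrix.sum_apply, map_sum, tensorMatrix, of_apply, map_prod]
    refine Finset.sum_congr rfl fun p _ => Finset.prod_congr rfl fun i _ => ?_
    by_cases hi : i = p
    · subst hi
      simp
    · simp [Function.update_of_ne hi, one_apply, apply_ite φ]
  have hsmul : ∀ (c : ℚ) (M : Matrix (Subsets n j) (Subsets n j) R),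
      (c • M).map φ = c • M.map φ := by
    intro c M
    ext
    simp
  rw [addCompound, addCompound, hsmul, ← hd, ← hw, Matrix.map_mul, Matrix.map_mul]
  rfl

theorem map_det_mixedCompound {S : Type*} [CommRing S] [Algebra ℚ S] (φ : R →ₐ[ℚ] S) (j k : ℕ)
    (A : Matrix (Fin n) (Fin n) R) (B : Matrix (Fin m) (Fin m) R) :
    φ (mixedCompound j k A B).det = (mixedCompound j k (A.map φ) (B.map φ)).det := by
  rw [AlgHom.map_det]
  congr 1
  ext ⟨a, b⟩ ⟨c, d⟩
  simp only [mixedCompound, AlgHom.mapMatrix_apply, map_apply, Matrix.add_apply,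
    kroneckerMap_apply, map_add, map_mul, ← map_addCompound, one_apply, apply_ite φ, map_one,
    map_zero]

theorem tensorMatrix_update_apply {j : ℕ} (p : Fin j) (A : Matrix (Fin n) (Fin n) ℚ)
    (w w' : Fin j → Fin n) :
    tensorMatrix (Function.update 1 p A) w w' =
      A (w p) (w' p) * ∏ i ∈ Finset.univ.erase p, (1 : Matrix (Fin n) (Fin n) ℚ) (w i) (w' i) := by
  rw [tensorMatrix, of_apply, ← Finset.mul_prod_erase _ _ (Finset.mem_univ p),
    Function.update_self]
  congr 1
  refine Finset.prod_congr rfl fun i hi => ?_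
  rw [Function.update_of_ne (Finset.ne_of_mem_erase hi), Pi.one_apply]

/-- The factor in the decomposition of `addCompound j (Xᵀ * Y)` as a sum of squares. -/
def addCompoundFactor {κ : Type*} (j : ℕ) (X : Matrix κ (Fin n) ℚ)
    (r : Fin j × κ × (Fin j → Fin n)) (S : Subsets n j) : ℚ :=
  (tensorMatrix (Function.update 1 r.1 (of fun _ b => X r.2.1 b)) * wedge n j ℚ) r.2.2 S

theorem addCompound_transpose_mul {κ : Type*} [Fintype κ] (hn : n ≠ 0) (j : ℕ)
    (X Y : Matrix κ (Fin n) ℚ) (S S' : Subsets n j) :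
    addCompound j (Xᵀ * Y) S S' = ∑ r, ((j.factorial : ℚ)⁻¹ * (n : ℚ)⁻¹) *
      addCompoundFactor j X r S * addCompoundFactor j Y r S' := by
  have hn' : (n : ℚ) ≠ 0 := by exact_mod_cast hn
  let T (Z : Matrix κ (Fin n) ℚ) (p : Fin j) (t : κ) :=
    tensorMatrix (Function.update 1 p (of fun (_ : Fin n) b => Z t b))
  have hT : derivWords (j := j) (Xᵀ * Y) = (n : ℚ)⁻¹ • ∑ p, ∑ t, (T X p t)ᵀ * T Y p t := by
    rw [derivWords, Finset.smul_sum]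
    refine Finset.sum_congr rfl fun p _ => ?_
    have hprod : ∀ t, (T X p t)ᵀ * T Y p t =
        tensorMatrix (Function.update 1 p (of fun a b => (n : ℚ) * (X t a * Y t b))) := by
      intro t
      rw [transpose_tensorMatrix, tensorMatrix_mul]
      congr 1
      funext i
      by_cases hi : i = p
      · subst hi
        ext a b
        simp [mul_apply]
      · simp [Function.update_of_ne hi]
    ext w w'
    rw [Finset.sum_congr rfl fun t _ => hprod t, tensorMatrix_update_apply, Matrix.smul_apply,
      Matrix.sum_apply]
    simp only [tensorMatrix_update_apply, of_apply, ← Finset.sum_mul, ← Finset.mul_sum, mul_apply,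
      transpose_apply, smul_eq_mul]
    rw [← mul_assoc, ← mul_assoc, inv_mul_cancel₀ hn', one_mul]
  rw [addCompound, hT, Matrix.mul_smul, Matrix.smul_mul, smul_smul, Matrix.smul_apply]
  simp only [Matrix.mul_sum, Matrix.sum_mul, Matrix.sum_apply, smul_eq_mul, Fintype.sum_prod_type,
    mul_assoc, ← Finset.mul_sum]
  congr 2
  refine Finset.sum_congr rfl fun p _ => Finset.sum_congr rfl fun t _ => ?_
  rw [← Matrix.mul_assoc, Matrix.mul_assoc _ (T Y p t), ← transpose_mul, mul_apply]
  rfl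

/-- Kernel form of the Cauchy–Binet formula: the determinant of a positive semidefinite
matrix-valued kernel is a positive semidefinite kernel. -/
theorem sum_mul_det_nonneg {Ω ρ V : Type*} [Fintype Ω] [Fintype ρ] [Fintype V] [DecidableEq V]
    (φ : Ω → ℚ) (K : Ω → Ω → Matrix V V ℚ) (w : ρ → ℚ) (hw : ∀ r, 0 ≤ w r) (L : Ω → ρ → V → ℚ)
    (hK : ∀ a b S S', K a b S S' = ∑ r, w r * L a r S * L b r S') :
    0 ≤ ∑ a, ∑ b, φ a * φ b * (K a b).det := by
  classical
  let d (f : V → ρ) (a : Ω) : ℚ := ∑ σ : Equiv.Perm V, ((σ.sign : ℤ) : ℚ) * ∏ S, L a (f S) (σ S)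
  have hdet : ∀ a b, ((Fintype.card V).factorial : ℚ) * (K a b).det =
      ∑ f : V → ρ, (∏ S, w (f S)) * (d f a * d f b) := by
    intro a b
    have h1 : ∀ σ : Equiv.Perm V, (K a b).det = ((σ.sign : ℤ) : ℚ) *
        ∑ τ : Equiv.Perm V, ((τ.sign : ℤ) : ℚ) * ∏ S, K a b (σ S) (τ S) := by
      intro σ
      have := det_permute σ (K a b)
      rw [← det_transpose, det_apply'] at this
      simp only [transpose_apply, submatrix_apply, id] at this
      rw [this, ← mul_assoc, ← Int.cast_mul, ← Units.val_mul, Int.units_mul_self]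
      simp
    have h2 : ((Fintype.card V).factorial : ℚ) * (K a b).det =
        ∑ σ : Equiv.Perm V, ((σ.sign : ℤ) : ℚ) *
          ∑ τ : Equiv.Perm V, ((τ.sign : ℤ) : ℚ) * ∏ S, K a b (σ S) (τ S) := by
      rw [← Finset.sum_congr rfl fun σ _ => h1 σ]
      simp [Fintype.card_perm]
    rw [h2]
    have h3 : ∀ σ τ : Equiv.Perm V, ∏ S, K a b (σ S) (τ S) =
        ∑ f : V → ρ, (∏ S, w (f S)) * (∏ S, L a (f S) (σ S)) * ∏ S, L b (f S) (τ S) := by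
      intro σ τ
      simp only [hK]
      rw [Finset.prod_univ_sum, Fintype.piFinset_univ]
      simp only [Finset.prod_mul_distrib]
    simp only [h3, d, Finset.mul_sum, Finset.sum_mul]
    rw [Finset.sum_congr rfl fun σ _ => Finset.sum_comm, Finset.sum_comm]
    refine Finset.sum_congr rfl fun f _ => ?_
    rw [Finset.sum_comm]
    refine Finset.sum_congr rfl fun σ _ => Finset.sum_congr rfl fun τ _ => ?_
    ring
  have hpos : (0 : ℚ) < (Fintype.card V).factorial := by exact_mod_cast Nat.factorial_pos _
  refine nonneg_of_mul_nonneg_right ?_ hpos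
  have : ((Fintype.card V).factorial : ℚ) * ∑ a, ∑ b, φ a * φ b * (K a b).det =
      ∑ f : V → ρ, (∏ S, w (f S)) * ((∑ a, φ a * d f a) * ∑ b, φ b * d f b) := by
    simp only [Finset.mul_sum, Finset.sum_mul]
    simp only [mul_left_comm ((Fintype.card V).factorial : ℚ), hdet, Finset.mul_sum]
    rw [Finset.sum_congr rfl fun a _ => Finset.sum_comm, Finset.sum_comm]
    refine Finset.sum_congr rfl fun f _ => ?_
    rw [Finset.sum_comm]
    refine Finset.sum_congr rfl fun σ _ => Finset.sum_congr rfl fun τ _ => ?_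
    ring
  rw [this]
  exact Finset.sum_nonneg fun f _ => mul_nonneg (Finset.prod_nonneg fun S _ => hw _)
    (mul_self_nonneg _)

theorem sum_mul_det_mixedCompound_nonneg {Ω κ κ' : Type*} [Fintype Ω] [Fintype κ] [Fintype κ']
    (hn : n ≠ 0) (hm : m ≠ 0) (j k : ℕ) (φ : Ω → ℚ) (M : Ω → Matrix κ (Fin n) ℚ)
    (M' : Ω → Matrix κ' (Fin m) ℚ) :
    0 ≤ ∑ a, ∑ b, φ a * φ b *
      (mixedCompound j k ((M a)ᵀ * M b) ((M' a)ᵀ * M' b)).det := by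
  refine sum_mul_det_nonneg (ρ := ((Fin j × κ × (Fin j → Fin n)) × Subsets m k) ⊕
      (Subsets n j × (Fin k × κ' × (Fin k → Fin m)))) φ _
    (Sum.elim (fun _ => (j.factorial : ℚ)⁻¹ * (n : ℚ)⁻¹)
      fun _ => (k.factorial : ℚ)⁻¹ * (m : ℚ)⁻¹) ?_
    (fun a => Sum.elim
      (fun r ST => addCompoundFactor j (M a) r.1 ST.1 * if r.2 = ST.2 then 1 else 0)
      fun r ST => (if r.1 = ST.1 then 1 else 0) * addCompoundFactor k (M' a) r.2 ST.2) ?_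
  · rintro (r | r) <;> simp only [Sum.elim_inl, Sum.elim_inr] <;> positivity
  · rintro a b ⟨S, T⟩ ⟨S', T'⟩
    rw [mixedCompound, Matrix.add_apply, kroneckerMap_apply, kroneckerMap_apply,
      addCompound_transpose_mul hn, addCompound_transpose_mul hm, Fintype.sum_sum_type]
    congr 1
    · conv_rhs => rw [Fintype.sum_prod_type]
      rw [Finset.sum_mul]
      refine Finset.sum_congr rfl fun r _ => ?_
      rw [Finset.sum_eq_single T]
      · simp [one_apply]
      · intro T'' _ hT
        simp [hT]
      · simp
    · conv_rhs => rw [Fintype.sum_prod_type]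
      rw [Finset.sum_eq_single (s := Finset.univ) S]
      · rw [Finset.mul_sum]
        refine Finset.sum_congr rfl fun r _ => ?_
        simp [one_apply]
      · intro S'' _ hS
        simp [hS]
      · simp

end MixedCompound

/-- The cells of the diagram with row lengths `lam`. -/
abbrev Cell {n : ℕ} (lam : Fin n → ℕ) : Type := Σ i : Fin n, Fin (lam i)

/-- The column of a cell. -/
abbrev Cell.col {n : ℕ} {lam : Fin n → ℕ} (c : Cell lam) : ℕ := c.2

/-- The permutations of the cells that preserve columns. -/
abbrev colPerms {n : ℕ} (lam : Fin n → ℕ) : Finset (Equiv.Perm (Cell lam)) :=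
  Finset.univ.filter fun π => ∀ c, (π c).col = c.col

/-- The sum of the first `r` entries of a sequence. -/
def prefixSum {n : ℕ} (lam : Fin n → ℕ) (r : ℕ) : ℕ :=
  ∑ i ∈ Finset.univ.filter (fun i : Fin n => (i : ℕ) < r), lam i

section Cells

variable {n : ℕ}

theorem Cell.ext' {lam : Fin n → ℕ} {c d : Cell lam} (hrow : c.1 = d.1) (hcol : c.col = d.col) :
    c = d := by
  obtain ⟨i, a⟩ := c
  obtain ⟨j, b⟩ := d
  obtain rfl : i = j := hrow
  obtain rfl : a = b := Fin.ext hcol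
  rfl

theorem card_cell (lam : Fin n → ℕ) : Fintype.card (Cell lam) = ∑ i, lam i := by
  simp [Cell]

theorem prefixSum_eq_card (lam : Fin n → ℕ) (r : ℕ) :
    prefixSum lam r = (Finset.univ.filter fun c : Cell lam => (c.1 : ℕ) < r).card := by
  rw [prefixSum, Finset.card_filter, Fintype.sum_sigma, Finset.sum_filter]
  refine Finset.sum_congr rfl fun i _ => ?_
  split_ifs with h <;> simp

/-- A labelling of the cells that is injective on columns has at most as many small labels as
there are cells in the top rows. -/
theorem card_label_lt_le {lam : Fin n → ℕ} (hlam : Antitone lam) (g : Cell lam → Fin n)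
    (hg : ∀ c d : Cell lam, c.col = d.col → g c = g d → c = d) (r : ℕ) :
    (Finset.univ.filter fun c => (g c : ℕ) < r).card ≤ prefixSum lam r := by
  classical
  rw [prefixSum_eq_card]
  set s := (Finset.univ : Finset (Cell lam)).image Cell.col with hs
  rw [Finset.card_eq_sum_card_fiberwise (f := Cell.col) (t := s)
      (fun c _ => by simp [hs]),
    Finset.card_eq_sum_card_fiberwise (f := Cell.col) (t := s)
      (fun c _ => by simp [hs])]
  refine Finset.sum_le_sum fun q _ => ?_
  by_cases hfull : ∀ i : Fin n, (i : ℕ) < r → q < lam i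
  · have h1 : ((Finset.univ.filter fun c => (g c : ℕ) < r).filter fun c => c.col = q).card ≤
        (Finset.univ.filter fun i : Fin n => (i : ℕ) < r).card := by
      refine Finset.card_le_card_of_injOn g (fun c hc => ?_) (fun c hc d hd h => ?_)
      · simp only [Finset.coe_filter, Finset.mem_filter, Finset.mem_univ, true_and,
          Set.mem_ofPred_eq] at hc ⊢
        exact hc.1
      · simp only [Finset.coe_filter, Finset.mem_filter, Finset.mem_univ, true_and,
          Set.mem_ofPred_eq] at hc hd
        exact hg c d (hc.2.trans hd.2.symm) h
    refine h1.trans ?_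
    have h2 : (Finset.univ.filter fun i : Fin n => (i : ℕ) < r) ⊆
        (((Finset.univ.filter fun c : Cell lam => (c.1 : ℕ) < r).filter
          fun c => c.col = q).image Sigma.fst) := by
      intro i hi
      rw [Finset.mem_filter] at hi
      rw [Finset.mem_image]
      exact ⟨⟨i, ⟨q, hfull i hi.2⟩⟩, by simp [hi.2], rfl⟩
    exact (Finset.card_le_card h2).trans Finset.card_image_le
  · push Not at hfull
    obtain ⟨i, hi, hq⟩ := hfull
    refine Finset.card_le_card fun c hc => ?_
    simp only [Finset.mem_filter, Finset.mem_univ, true_and] at hc ⊢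
    refine ⟨?_, hc.2⟩
    by_contra hlt
    have hic : i ≤ c.1 := Fin.le_def.mpr (by omega)
    have h3 := hlam hic
    have h4 := c.2.2
    have h5 : (c.2 : ℕ) = q := hc.2
    omega

end Cells

section Functional

variable {n : ℕ}

/-- The index set of the positive functional attached to a diagram: signs on the cells and a
column-preserving permutation. -/
abbrev SignedColPerm (lam : Fin n → ℕ) : Type := (Cell lam → ℤˣ) × {π // π ∈ colPerms lam}

/-- The weight of a signed column permutation. -/
def signWeight (lam : Fin n → ℕ) (a : SignedColPerm lam) : ℚ :=
  ((∏ t, a.1 t : ℤˣ) : ℤ) * ((Equiv.Perm.sign a.2.1 : ℤ) : ℚ)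

/-- The matrix sending a cell to the row of its image, with a sign. -/
def signMatrix (lam : Fin n → ℕ) (a : SignedColPerm lam) : Matrix (Cell lam) (Fin n) ℚ :=
  Matrix.of fun t i => if (a.2.1 t).1 = i then ((a.1 t : ℤ) : ℚ) else 0

/-- The positive functional attached to a diagram. -/
def cellFunctional (lam : Fin n → ℕ) (f : Matrix (Fin n) (Fin n) ℚ → ℚ) : ℚ :=
  ∑ a, ∑ b, signWeight lam a * signWeight lam b *
    f ((signMatrix lam a).transpose * signMatrix lam b)

theorem cellFunctional_smul (lam : Fin n → ℕ) (c : ℚ) (f : Matrix (Fin n) (Fin n) ℚ → ℚ) :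
    cellFunctional lam (fun A => c * f A) = c * cellFunctional lam f := by
  simp only [cellFunctional, Finset.mul_sum]
  refine Finset.sum_congr rfl fun a _ => Finset.sum_congr rfl fun b _ => by ring

theorem cellFunctional_sum (lam : Fin n → ℕ) {ι : Type*} (s : Finset ι)
    (f : ι → Matrix (Fin n) (Fin n) ℚ → ℚ) :
    cellFunctional lam (fun A => ∑ i ∈ s, f i A) = ∑ i ∈ s, cellFunctional lam (f i) := by
  simp only [cellFunctional, Finset.mul_sum]
  exact (Finset.sum_congr rfl fun a _ => Finset.sum_comm).trans Finset.sum_comm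

/-- The sum over all signs detecting which words of cells are bijective. -/
def signSum {ι κ : Type*} [Fintype ι] [Fintype κ] [DecidableEq κ] (v : ι → κ) : ℚ :=
  ∑ ε : κ → ℤˣ, (((∏ t, ε t : ℤˣ) : ℤ) : ℚ) * ∏ i, ((ε (v i) : ℤ) : ℚ)

theorem signSum_of_not_surjective {ι κ : Type*} [Fintype ι] [Fintype κ] [DecidableEq κ]
    {v : ι → κ} (hv : ¬ Function.Surjective v) : signSum v = 0 := by
  simp only [Function.Surjective, not_forall, not_exists] at hv
  obtain ⟨t, ht⟩ := hv
  refine Finset.sum_involution (fun ε _ => Function.update ε t (-ε t)) ?_ ?_ ?_ ?_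
  · intro ε _
    have h1 : ∏ s, Function.update ε t (-ε t) s = -∏ s, ε s := by
      rw [Finset.prod_update_of_mem (Finset.mem_univ t),
        ← Finset.mul_prod_erase Finset.univ ε (Finset.mem_univ t), Finset.sdiff_singleton_eq_erase,
        neg_mul]
    have h2 : ∏ i, ((Function.update ε t (-ε t) (v i) : ℤ) : ℚ) = ∏ i, ((ε (v i) : ℤ) : ℚ) :=
      Finset.prod_congr rfl fun i _ => by rw [Function.update_of_ne (ht i)]
    rw [h1, h2]
    push_cast
    ring
  · intro ε _ _ h
    have := congrFun h t
    rw [Function.update_self] at this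
    exact neg_units_ne_self _ this
  · simp
  · simp

theorem signSum_of_bijective {ι κ : Type*} [Fintype ι] [Fintype κ] [DecidableEq κ]
    {v : ι → κ} (hv : Function.Bijective v) : signSum v = Fintype.card (κ → ℤˣ) := by
  have : ∀ ε : κ → ℤˣ, (((∏ t, ε t : ℤˣ) : ℤ) : ℚ) * ∏ i, ((ε (v i) : ℤ) : ℚ) = 1 := by
    intro ε
    rw [hv.prod_comp fun t => ((ε t : ℤ) : ℚ)]
    push_cast
    rw [← Finset.prod_mul_distrib]
    refine Finset.prod_eq_one fun t _ => ?_
    rcases Int.units_eq_one_or (ε t) with h | h <;> simp [h]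
  rw [signSum, Finset.sum_congr rfl fun ε _ => this ε]
  simp

theorem permTrace_signMatrix {ι : Type*} [Fintype ι] [DecidableEq ι] (lam : Fin n → ℕ)
    (σ : Equiv.Perm ι) (a b : SignedColPerm lam) :
    permTrace σ ((signMatrix lam a).transpose * signMatrix lam b) =
      ∑ v : ι → Cell lam, (∏ i, ((a.1 (v i) : ℤ) : ℚ)) * (∏ i, ((b.1 (v i) : ℤ) : ℚ)) *
        if ∀ i, (b.2.1 (v i)).1 = (a.2.1 (v (σ i))).1 then 1 else 0 := by
  rw [permTrace_mul, Finset.sum_comm]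
  refine Finset.sum_congr rfl fun v _ => ?_
  rw [Finset.sum_eq_single fun i => (a.2.1 (v i)).1]
  · simp only [signMatrix, Matrix.transpose_apply, Matrix.of_apply, if_true]
    rw [mul_assoc]
    congr 1
    split_ifs with h
    · simp [h]
    · push Not at h
      obtain ⟨i, hi⟩ := h
      rw [mul_zero]
      exact Finset.prod_eq_zero (Finset.mem_univ i) (if_neg hi)
  · intro w _ hw
    obtain ⟨i, hi⟩ := Function.ne_iff.mp hw
    rw [Finset.prod_eq_zero (Finset.mem_univ i), zero_mul]
    simp [signMatrix, Ne.symm hi]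
  · simp

/-- The signed number of pairs of column permutations matching a word of cells with its
`σ`-translate. -/
def matchSum {ι : Type*} [Fintype ι] (lam : Fin n → ℕ) (σ : Equiv.Perm ι) (v : ι → Cell lam) : ℚ :=
  ∑ π ∈ colPerms lam, ∑ ρ ∈ colPerms lam, ((π.sign : ℤ) : ℚ) * ((ρ.sign : ℤ) : ℚ) *
    if ∀ i, (ρ (v i)).1 = (π (v (σ i))).1 then 1 else 0

theorem sum_prod_mul_separated {α β : Type*} [Fintype α] [Fintype β] (E : α → ℚ) (m : β → β → ℚ) :
    ∑ a : α × β, ∑ b : α × β, E a.1 * E b.1 * m a.2 b.2 = (∑ e, E e) ^ 2 * ∑ π, ∑ ρ, m π ρ := by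
  simp only [Fintype.sum_prod_type]
  simp only [← Finset.mul_sum, ← Finset.sum_mul]
  ring

theorem cellFunctional_permTrace {ι : Type*} [Fintype ι] [DecidableEq ι] (lam : Fin n → ℕ)
    (σ : Equiv.Perm ι) :
    cellFunctional lam (permTrace σ) = ∑ v : ι → Cell lam, signSum v ^ 2 * matchSum lam σ v := by
  simp only [cellFunctional, permTrace_signMatrix, Finset.mul_sum]
  refine ((Finset.sum_congr rfl fun a _ => Finset.sum_comm).trans Finset.sum_comm).trans ?_
  refine Finset.sum_congr rfl fun v _ => ?_
  have h := sum_prod_mul_separated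
    (fun ε : Cell lam → ℤˣ => (((∏ t, ε t : ℤˣ) : ℤ) : ℚ) * ∏ i, ((ε (v i) : ℤ) : ℚ))
    (fun π ρ : {π // π ∈ colPerms lam} => ((π.1.sign : ℤ) : ℚ) * ((ρ.1.sign : ℤ) : ℚ) *
      if ∀ i, (ρ.1 (v i)).1 = (π.1 (v (σ i))).1 then (1 : ℚ) else 0)
  have hm : matchSum lam σ v = ∑ π : {π // π ∈ colPerms lam}, ∑ ρ : {π // π ∈ colPerms lam},
      ((π.1.sign : ℤ) : ℚ) * ((ρ.1.sign : ℤ) : ℚ) *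
        if ∀ i, (ρ.1 (v i)).1 = (π.1 (v (σ i))).1 then (1 : ℚ) else 0 := by
    rw [matchSum, ← Finset.sum_coe_sort]
    refine Finset.sum_congr rfl fun π _ => ?_
    rw [← Finset.sum_coe_sort]
  rw [signSum, hm, ← h]
  refine Finset.sum_congr rfl fun a _ => Finset.sum_congr rfl fun b _ => ?_
  simp only [signWeight]
  ring

end Functional

section ColPerms

variable {n : ℕ} {lam : Fin n → ℕ}

theorem one_mem_colPerms : (1 : Equiv.Perm (Cell lam)) ∈ colPerms lam := by simp

theorem mul_mem_colPerms {π ρ : Equiv.Perm (Cell lam)} (hπ : π ∈ colPerms lam)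
    (hρ : ρ ∈ colPerms lam) : π * ρ ∈ colPerms lam := by
  simp only [colPerms, Finset.mem_filter, Finset.mem_univ, true_and] at *
  intro c
  rw [Equiv.Perm.mul_apply, hπ, hρ]

theorem inv_mem_colPerms {π : Equiv.Perm (Cell lam)} (hπ : π ∈ colPerms lam) :
    π⁻¹ ∈ colPerms lam := by
  simp only [colPerms, Finset.mem_filter, Finset.mem_univ, true_and] at *
  intro c
  rw [← hπ (π⁻¹ c), ← Equiv.Perm.mul_apply, mul_inv_cancel, Equiv.Perm.one_apply]

theorem swap_mem_colPerms {c d : Cell lam} (h : c.col = d.col) :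
    Equiv.swap c d ∈ colPerms lam := by
  simp only [colPerms, Finset.mem_filter, Finset.mem_univ, true_and]
  intro e
  rw [Equiv.swap_apply_def]
  split_ifs with h1 h2
  · rw [h1, h]
  · rw [h2, h]
  · rfl

theorem sum_colPerms_mul_left {τ : Equiv.Perm (Cell lam)} (hτ : τ ∈ colPerms lam)
    (f : Equiv.Perm (Cell lam) → ℚ) :
    ∑ σ ∈ colPerms lam, f (τ * σ) = ∑ σ ∈ colPerms lam, f σ := by
  refine Finset.sum_equiv (Equiv.mulLeft τ) (fun σ => ⟨fun h => mul_mem_colPerms hτ h, fun h => ?_⟩)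
    fun σ _ => rfl
  have := mul_mem_colPerms (inv_mem_colPerms hτ) h
  rwa [Equiv.coe_mulLeft, inv_mul_cancel_left] at this

theorem sum_colPerms_mul_right {τ : Equiv.Perm (Cell lam)} (hτ : τ ∈ colPerms lam)
    (f : Equiv.Perm (Cell lam) → ℚ) :
    ∑ σ ∈ colPerms lam, f (σ * τ) = ∑ σ ∈ colPerms lam, f σ := by
  refine Finset.sum_equiv (Equiv.mulRight τ)
    (fun σ => ⟨fun h => mul_mem_colPerms h hτ, fun h => ?_⟩)
    fun σ _ => rfl
  have := mul_mem_colPerms h (inv_mem_colPerms hτ)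
  rwa [Equiv.coe_mulRight, mul_inv_cancel_right] at this

theorem eq_one_of_mem_colPerms {π : Equiv.Perm (Cell lam)} (hπ : π ∈ colPerms lam)
    (h : ∀ c, (π c).1 = c.1) : π = 1 :=
  Equiv.ext fun c => Cell.ext' (h c) ((Finset.mem_filter.mp hπ).2 c)

/-- A signed sum over column permutations vanishes on functions invariant under a column
transposition. -/
theorem sum_sign_mul_eq_zero {c d : Cell lam} (hcd : c ≠ d) (hcol : c.col = d.col)
    (f : Equiv.Perm (Cell lam) → ℚ) (hf : ∀ σ, f (Equiv.swap c d * σ) = f σ) :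
    ∑ σ ∈ colPerms lam, ((σ.sign : ℤ) : ℚ) * f σ = 0 := by
  have h := sum_colPerms_mul_left (swap_mem_colPerms hcol) fun σ => ((σ.sign : ℤ) : ℚ) * f σ
  have h2 : ∑ σ ∈ colPerms lam, (((Equiv.swap c d * σ).sign : ℤ) : ℚ) * f (Equiv.swap c d * σ) =
      -∑ σ ∈ colPerms lam, ((σ.sign : ℤ) : ℚ) * f σ := by
    rw [← Finset.sum_neg_distrib]
    refine Finset.sum_congr rfl fun σ _ => ?_
    rw [hf, Equiv.Perm.sign_mul, Equiv.Perm.sign_swap hcd]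
    push_cast
    ring
  linarith

end ColPerms

section Vanishing

variable {n : ℕ} {lam : Fin n → ℕ}

theorem bijective_of_signSum_ne_zero {ι κ : Type*} [Fintype ι] [Fintype κ] [DecidableEq κ]
    (h : Fintype.card ι ≤ Fintype.card κ) {v : ι → κ} (hv : signSum v ≠ 0) :
    Function.Bijective v := by
  have hs : Function.Surjective v := by
    by_contra hs
    exact hv (signSum_of_not_surjective hs)
  exact (Fintype.bijective_iff_surjective_and_card v).mpr
    ⟨hs, le_antisymm h (Fintype.card_le_of_surjective v hs)⟩

theorem matchSum_mul_swap {ι : Type*} [Fintype ι] [DecidableEq ι] {v : ι → Cell lam}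
    (hv : Function.Injective v) {s s' : ι} (hss : s ≠ s') (hcol : (v s).col = (v s').col)
    (σ : Equiv.Perm ι) : matchSum lam (σ * Equiv.swap s s') v = -matchSum lam σ v := by
  rw [matchSum, matchSum, ← Finset.sum_neg_distrib]
  refine Finset.sum_congr rfl fun π _ => ?_
  rw [← sum_colPerms_mul_right (swap_mem_colPerms hcol), ← Finset.sum_neg_distrib]
  refine Finset.sum_congr rfl fun ρ _ => ?_
  have hiff : (∀ i, ((ρ * Equiv.swap (v s) (v s')) (v i)).1 =
      (π (v ((σ * Equiv.swap s s') i))).1) ↔ ∀ i, (ρ (v i)).1 = (π (v (σ i))).1 := by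
    have h1 : ∀ i, Equiv.swap (v s) (v s') (v i) = v (Equiv.swap s s' i) := fun i =>
      hv.swap_apply s s' i
    simp only [Equiv.Perm.mul_apply, h1]
    exact (Equiv.swap s s').forall_congr_right (q := fun i => (ρ (v i)).1 = (π (v (σ i))).1)
  rw [if_congr hiff rfl rfl, Equiv.Perm.sign_mul, Equiv.Perm.sign_swap (hv.ne hss)]
  push_cast
  ring

theorem prod_hMatrix (α : Fin n → ℕ) (A : Matrix (Fin n) (Fin n) ℚ) :
    ∏ i, hMatrix (α i) A = (∏ i, ((α i).factorial : ℚ)⁻¹) *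
      ∑ σ : ∀ i, Equiv.Perm (Fin (α i)), permTrace (Equiv.Perm.sigmaCongrRight σ) A := by
  simp only [hMatrix, smul_eq_mul, Finset.prod_mul_distrib, permTrace_sigma]
  rw [Finset.prod_univ_sum, Fintype.piFinset_univ]

theorem sigmaCongrRight_mul_mulSingle {α : Fin n → ℕ} (σ : ∀ i, Equiv.Perm (Fin (α i)))
    (i : Fin n) (a b : Fin (α i)) :
    Equiv.Perm.sigmaCongrRight (σ * Pi.mulSingle i (Equiv.swap a b)) =
      Equiv.Perm.sigmaCongrRight σ * Equiv.swap (⟨i, a⟩ : Σ i, Fin (α i)) ⟨i, b⟩ := by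
  rw [← Equiv.Perm.sigmaCongrRight_mul]
  congr 1
  ext1 ⟨k, c⟩
  by_cases hk : k = i
  · subst hk
    change (⟨k, (Pi.mulSingle k (Equiv.swap a b) : ∀ i, Equiv.Perm (Fin (α i))) k c⟩ :
      Σ i, Fin (α i)) = _
    rw [Pi.mulSingle_eq_same]
    exact ((sigma_mk_injective (β := fun i => Fin (α i)) (i := k)).swap_apply a b c).symm
  · rw [Equiv.swap_apply_of_ne_of_ne (by simp [hk]) (by simp [hk])]
    simp [Pi.mulSingle_eq_of_ne hk]

/-- The functional of a diagram detects only products of complete symmetric functions of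
degrees dominated by the row lengths. -/
theorem prefixSum_le_of_cellFunctional_prod_hMatrix_ne_zero (hlam : Antitone lam) {α : Fin n → ℕ}
    (hα : ∑ i, α i ≤ ∑ i, lam i)
    (h : cellFunctional lam (fun A => ∏ i, hMatrix (α i) A) ≠ 0) :
    ∑ i, α i = ∑ i, lam i ∧ ∀ r, prefixSum α r ≤ prefixSum lam r := by
  simp only [prod_hMatrix] at h
  rw [cellFunctional_smul, cellFunctional_sum] at h
  replace h := right_ne_zero_of_mul h
  have hrw : ∀ σ : ∀ i, Equiv.Perm (Fin (α i)),
      cellFunctional lam (fun A => permTrace (Equiv.Perm.sigmaCongrRight σ) A) =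
      ∑ v, signSum v ^ 2 * matchSum lam (Equiv.Perm.sigmaCongrRight σ) v := fun σ =>
    cellFunctional_permTrace lam _
  rw [Finset.sum_congr rfl fun σ _ => hrw σ, Finset.sum_comm] at h
  obtain ⟨v, -, hv⟩ := Finset.exists_ne_zero_of_sum_ne_zero h
  rw [← Finset.mul_sum] at hv
  have hbij : Function.Bijective v := bijective_of_signSum_ne_zero
    (by rw [card_cell, card_cell]; exact hα) (fun h0 => hv (by rw [h0]; ring))
  have hcard : ∑ i, α i = ∑ i, lam i := by
    rw [← card_cell, ← card_cell]
    exact Fintype.card_of_bijective hbij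
  refine ⟨hcard, fun r => ?_⟩
  let e := Equiv.ofBijective v hbij
  have hle := card_label_lt_le hlam (fun c => (e.symm c).1) (fun c d hcol hrow => ?_) r
  · refine le_of_eq_of_le ?_ hle
    rw [prefixSum_eq_card]
    refine Finset.card_equiv e fun c => by simp
  · by_contra hcd
    refine hv (mul_eq_zero_of_right _ ?_)
    obtain ⟨⟨i, a⟩, rfl⟩ := e.surjective c
    obtain ⟨⟨i', b⟩, rfl⟩ := e.surjective d
    simp only [Equiv.symm_apply_apply] at hrow
    subst hrow
    have hss : (⟨i, a⟩ : Σ i, Fin (α i)) ≠ ⟨i, b⟩ := fun h => hcd (by rw [h])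
    have hre := Equiv.sum_comp (Equiv.mulRight (Pi.mulSingle i (Equiv.swap a b)))
      fun σ : ∀ i, Equiv.Perm (Fin (α i)) => matchSum lam (Equiv.Perm.sigmaCongrRight σ) v
    simp only [Equiv.coe_mulRight, sigmaCongrRight_mul_mulSingle] at hre
    simp only [matchSum_mul_swap hbij.injective hss hcol, Finset.sum_neg_distrib] at hre
    linarith

/-- The class function of the product of elementary symmetric functions of degrees the column
lengths, up to a scalar. -/
def colTrace (mu : Fin n → ℕ) {R : Type*} [CommRing R] (A : Matrix (Fin n) (Fin n) R) : R :=
  ∑ σ ∈ colPerms mu, ((σ.sign : ℤ) : R) * permTrace σ A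

theorem cellFunctional_colTrace (lam mu : Fin n → ℕ) :
    cellFunctional lam (colTrace mu) =
      ∑ v, signSum v ^ 2 * ∑ σ ∈ colPerms mu, ((σ.sign : ℤ) : ℚ) * matchSum lam σ v := by
  have h : cellFunctional lam (colTrace mu) = ∑ σ ∈ colPerms mu,
      ((σ.sign : ℤ) : ℚ) * ∑ v, signSum v ^ 2 * matchSum lam σ v := by
    simp only [← cellFunctional_permTrace]
    exact (cellFunctional_sum lam (colPerms mu) _).trans
      (Finset.sum_congr rfl fun σ _ => cellFunctional_smul lam _ _)
  rw [h]
  simp only [Finset.mul_sum]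
  rw [Finset.sum_comm]
  refine Finset.sum_congr rfl fun v _ => Finset.sum_congr rfl fun σ _ => by ring

theorem prefixSum_le_of_cellFunctional_colTrace_ne_zero {mu : Fin n → ℕ} (hmu : Antitone mu)
    (hcard : ∑ i, mu i = ∑ i, lam i) (h : cellFunctional lam (colTrace mu) ≠ 0) (r : ℕ) :
    prefixSum lam r ≤ prefixSum mu r := by
  rw [cellFunctional_colTrace] at h
  obtain ⟨v, -, hv⟩ := Finset.exists_ne_zero_of_sum_ne_zero h
  have hbij : Function.Bijective v := bijective_of_signSum_ne_zero
    (by rw [card_cell, card_cell, hcard]) (fun h0 => hv (by rw [h0]; ring))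
  replace hv := right_ne_zero_of_mul hv
  simp only [matchSum, Finset.mul_sum] at hv
  rw [Finset.sum_comm] at hv
  obtain ⟨π, -, hv⟩ := Finset.exists_ne_zero_of_sum_ne_zero hv
  rw [Finset.sum_comm] at hv
  obtain ⟨ρ, -, hv⟩ := Finset.exists_ne_zero_of_sum_ne_zero hv
  let e := (Equiv.ofBijective v hbij).trans π
  have hle := card_label_lt_le hmu (fun c => (e c).1) (fun c d hcol hrow => ?_) r
  · refine le_of_eq_of_le ?_ hle
    rw [prefixSum_eq_card]
    refine (Finset.card_equiv e fun c => by simp).symm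
  · by_contra hcd
    refine hv (sum_sign_mul_eq_zero hcd hcol _ fun σ => ?_)
    have hinv : ∀ x, (π (v (Equiv.swap c d x))).1 = (π (v x)).1 := by
      intro x
      rw [Equiv.swap_apply_def]
      split_ifs with h1 h2
      · rw [h1]; exact hrow.symm
      · rw [h2]; exact hrow
      · rfl
    simp only [Equiv.Perm.mul_apply, hinv]

end Vanishing

section Positivity

variable {n : ℕ}

theorem signSum_comp_perm {ι κ : Type*} [Fintype ι] [Fintype κ] [DecidableEq κ]
    (v : ι → κ) (ρ : Equiv.Perm ι) : signSum (v ∘ ρ) = signSum v := by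
  refine Finset.sum_congr rfl fun ε _ => ?_
  rw [← Equiv.prod_comp ρ fun i => ((ε (v i) : ℤ) : ℚ)]
  rfl

theorem sum_sum_sq_indicator {γ β : Type*} [Fintype β] [DecidableEq β] (s : Finset γ) (q : γ → ℚ)
    (x : γ → β) :
    ∑ p ∈ s, ∑ p' ∈ s, q p * q p' * (if x p' = x p then 1 else 0) =
      ∑ u, (∑ p ∈ s, q p * if x p = u then 1 else 0) ^ 2 := by
  simp only [sq, Finset.sum_mul_sum]
  refine Eq.trans ?_ Finset.sum_comm
  refine Finset.sum_congr rfl fun p _ => ?_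
  rw [Finset.sum_comm]
  refine Finset.sum_congr rfl fun p' _ => ?_
  rw [Finset.sum_eq_single (x p)]
  · simp
  · intro u _ hu
    simp [Ne.symm hu]
  · simp

theorem sum_colTrace_translates (lam : Fin n → ℕ) (v : Cell lam → Cell lam) :
    ∑ ρ ∈ colPerms lam, ∑ σ ∈ colPerms lam, ((σ.sign : ℤ) : ℚ) * matchSum lam σ (v ∘ ρ) =
      ∑ u : Cell lam → Fin n, (∑ p ∈ colPerms lam ×ˢ colPerms lam,
        (((p.1.sign : ℤ) : ℚ) * ((p.2.sign : ℤ) : ℚ)) *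
          if (fun i => (p.1 (v (p.2 i))).1) = u then 1 else 0) ^ 2 := by
  rw [← sum_sum_sq_indicator]
  simp only [Finset.sum_product]
  have h1 : ∀ ρ ∈ colPerms lam, ∑ σ ∈ colPerms lam, ((σ.sign : ℤ) : ℚ) * matchSum lam σ (v ∘ ρ) =
      ∑ σ ∈ colPerms lam, ∑ π ∈ colPerms lam, ∑ π' ∈ colPerms lam,
        ((π.sign : ℤ) : ℚ) * ((σ.sign : ℤ) : ℚ) * (((π'.sign : ℤ) : ℚ) * ((ρ.sign : ℤ) : ℚ)) *
        if (fun i => (π' (v (ρ i))).1) = (fun i => (π (v (σ i))).1) then 1 else 0 := by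
    intro ρ hρ
    rw [← sum_colPerms_mul_left (inv_mem_colPerms hρ)]
    refine Finset.sum_congr rfl fun σ _ => ?_
    rw [matchSum, Finset.mul_sum]
    refine Finset.sum_congr rfl fun π _ => ?_
    rw [Finset.mul_sum]
    refine Finset.sum_congr rfl fun π' _ => ?_
    have hiff : (∀ i, (π' ((v ∘ ρ) i)).1 = (π ((v ∘ ρ) ((ρ⁻¹ * σ) i))).1) ↔
        (fun i => (π' (v (ρ i))).1) = (fun i => (π (v (σ i))).1) := by
      simp [funext_iff]
    rw [if_congr hiff rfl rfl, Equiv.Perm.sign_mul, Equiv.Perm.sign_inv]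
    push_cast
    ring
  rw [Finset.sum_congr rfl h1]
  rw [Finset.sum_comm]
  exact (Finset.sum_congr rfl fun σ _ =>
    Finset.sum_comm.trans (Finset.sum_congr rfl fun π _ => Finset.sum_comm)).trans Finset.sum_comm

theorem cellFunctional_colTrace_self_pos (lam : Fin n → ℕ) :
    0 < cellFunctional lam (colTrace lam) := by
  set B : (Cell lam → Cell lam) → ℚ := fun v =>
    ∑ σ ∈ colPerms lam, ((σ.sign : ℤ) : ℚ) * matchSum lam σ v with hB
  have htranslate : ∀ ρ : Equiv.Perm (Cell lam), ∑ v, signSum v ^ 2 * B v =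
      ∑ v, signSum v ^ 2 * B (v ∘ ρ) := by
    intro ρ
    rw [← Equiv.sum_comp (ρ.arrowCongr (Equiv.refl (Cell lam))).symm]
    refine Finset.sum_congr rfl fun v _ => ?_
    rw [← signSum_comp_perm v ρ]
    rfl
  have havg : ((colPerms lam).card : ℚ) * cellFunctional lam (colTrace lam) =
      ∑ v, signSum v ^ 2 * ∑ ρ ∈ colPerms lam, B (v ∘ ρ) := by
    rw [cellFunctional_colTrace, ← nsmul_eq_mul, ← Finset.sum_const]
    refine (Finset.sum_congr rfl fun ρ _ => htranslate ρ).trans (Finset.sum_comm.trans ?_)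
    exact Finset.sum_congr rfl fun v _ => (Finset.mul_sum _ _ _).symm
  have hpos : 0 < ∑ v, signSum v ^ 2 * ∑ ρ ∈ colPerms lam, B (v ∘ ρ) := by
    refine Finset.sum_pos' (fun v _ => ?_) ⟨id, Finset.mem_univ _, ?_⟩
    · rw [sum_colTrace_translates]
      positivity
    · rw [sum_colTrace_translates, signSum_of_bijective Function.bijective_id]
      refine mul_pos (by positivity) ?_
      refine Finset.sum_pos' (fun u _ => sq_nonneg _) ⟨fun c => c.1, Finset.mem_univ _, ?_⟩
      refine pow_pos ?_ 2
      have hterm : ∀ p ∈ colPerms lam ×ˢ colPerms lam,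
          (((p.1.sign : ℤ) : ℚ) * ((p.2.sign : ℤ) : ℚ)) *
            (if (fun i => (p.1 (id (p.2 i))).1) = (fun c : Cell lam => c.1) then (1 : ℚ) else 0) =
          if p.1 * p.2 = 1 then 1 else 0 := by
        intro p hp
        rw [Finset.mem_product] at hp
        have hiff : ((fun i => (p.1 (id (p.2 i))).1) = fun c : Cell lam => c.1) ↔
            p.1 * p.2 = 1 := by
          refine ⟨fun h => eq_one_of_mem_colPerms (mul_mem_colPerms hp.1 hp.2)
            fun c => congrFun h c,
            fun h => funext fun c => ?_⟩
          have := congrArg (fun τ : Equiv.Perm (Cell lam) => (τ c).1) h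
          exact this
        rw [if_congr hiff rfl rfl]
        split_ifs with h
        · have := congrArg (fun τ => ((Equiv.Perm.sign τ : ℤ) : ℚ)) h
          simp only [Equiv.Perm.sign_mul] at this
          push_cast at this
          rw [mul_one, this]
          simp
        · simp
      rw [Finset.sum_congr rfl hterm]
      refine Finset.sum_pos' (fun p _ => by split_ifs <;> simp) ⟨(1, 1), ?_, by simp⟩
      exact Finset.mem_product.mpr ⟨one_mem_colPerms, one_mem_colPerms⟩
  rw [← havg] at hpos
  exact (pos_iff_pos_of_mul_pos hpos).mp
    (Nat.cast_pos.mpr (Finset.card_pos.mpr ⟨1, one_mem_colPerms⟩))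

end Positivity

section Schur

variable {n : ℕ}

theorem sum_filter_lt_le_sum_perm (w : Equiv.Perm (Fin n)) (r : ℕ) :
    ∑ i ∈ Finset.univ.filter (fun i : Fin n => (i : ℕ) < r), ((i : ℕ) : ℤ) ≤
      ∑ i ∈ Finset.univ.filter (fun i : Fin n => (i : ℕ) < r), ((w i : ℕ) : ℤ) := by
  have h : Antivary (fun i : Fin n => if (i : ℕ) < r then (1 : ℤ) else 0)
      (fun i : Fin n => ((i : ℕ) : ℤ)) := by
    intro i j hij
    have hij' : ((i : ℕ) : ℤ) < ((j : ℕ) : ℤ) := hij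
    dsimp only
    split_ifs <;> omega
  have := h.sum_mul_le_sum_mul_comp_perm (σ := w)
  simpa only [ite_mul, one_mul, zero_mul, ← Finset.sum_filter] using this

/-- The functional of a diagram detects only Schur functions of partitions it dominates. -/
theorem prefixSum_le_of_cellFunctional_schurMatrix_ne_zero {lam nu : Fin n → ℕ}
    (hlam : Antitone lam) (hnu : ∑ i, nu i ≤ ∑ i, lam i)
    (h : cellFunctional lam (schurMatrix nu) ≠ 0) :
    ∑ i, nu i = ∑ i, lam i ∧ ∀ r, prefixSum nu r ≤ prefixSum lam r := by
  have hexp : cellFunctional lam (schurMatrix nu) = ∑ w : Equiv.Perm (Fin n),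
      ((w.sign : ℤ) : ℚ) * cellFunctional lam
        (fun A => ∏ i, hMatrixInt ((nu i : ℤ) - (i : ℤ) + (w i : ℤ)) A) := by
    simp only [← cellFunctional_smul]
    rw [← cellFunctional_sum]
    congr 1
    ext A
    rw [schurMatrix, ← Matrix.det_transpose, Matrix.det_apply']
    rfl
  rw [hexp] at h
  obtain ⟨w, -, hw⟩ := Finset.exists_ne_zero_of_sum_ne_zero h
  replace hw := right_ne_zero_of_mul hw
  have hnonneg : ∀ i, 0 ≤ (nu i : ℤ) - (i : ℤ) + (w i : ℤ) := by
    intro i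
    by_contra hi
    refine hw ?_
    have hz : ∀ A : Matrix (Fin n) (Fin n) ℚ,
        ∏ i, hMatrixInt ((nu i : ℤ) - (i : ℤ) + (w i : ℤ)) A = 0 := fun A =>
      Finset.prod_eq_zero (Finset.mem_univ i) (if_neg hi)
    simp [hz, cellFunctional]
  set α : Fin n → ℕ := fun i => ((nu i : ℤ) - (i : ℤ) + (w i : ℤ)).toNat with hα
  have hαi : ∀ i, (α i : ℤ) = (nu i : ℤ) - (i : ℤ) + (w i : ℤ) := fun i =>
    Int.toNat_of_nonneg (hnonneg i)
  have hsum : ∑ i, α i = ∑ i, nu i := by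
    have h1 : ∑ i, (α i : ℤ) = ∑ i, (nu i : ℤ) := by
      simp only [hαi, Finset.sum_add_distrib, Finset.sum_sub_distrib]
      rw [Equiv.sum_comp w fun i => ((i : ℕ) : ℤ)]
      ring
    exact_mod_cast h1
  have hw' : cellFunctional lam (fun A => ∏ i, hMatrix (α i) A) ≠ 0 := by
    convert hw using 4 with A i
    exact (if_pos (hnonneg i)).symm
  obtain ⟨h1, h2⟩ := prefixSum_le_of_cellFunctional_prod_hMatrix_ne_zero hlam
    (hsum.trans_le hnu) hw'
  refine ⟨hsum.symm.trans h1, fun r => le_trans ?_ (h2 r)⟩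
  have h3 := sum_filter_lt_le_sum_perm w r
  have h4 : (prefixSum nu r : ℤ) ≤ prefixSum α r := by
    simp only [prefixSum, Nat.cast_sum, hαi, Finset.sum_add_distrib, Finset.sum_sub_distrib]
    linarith
  exact_mod_cast h4

end Schur

section Transfer

variable {n m : ℕ}

theorem aeval_sumElim_schurX {R : Type*} [CommRing R] [Algebra ℚ R] (x : Fin n → R) (y : Fin m → R)
    (lam : Fin n → ℕ) : aeval (Sum.elim x y) (schurX n m lam) = aeval x (schur n lam) := by
  rw [schurX, aeval_rename, Sum.elim_comp_inl]

theorem aeval_sumElim_schurY {R : Type*} [CommRing R] [Algebra ℚ R] (x : Fin n → R) (y : Fin m → R)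
    (mu : Fin m → ℕ) : aeval (Sum.elim x y) (schurY n m mu) = aeval y (schur m mu) := by
  rw [schurY, aeval_rename, Sum.elim_comp_inr]

/-- The Schur expansion of a symmetric polynomial lifts to invariant functions of matrices. -/
theorem eq_sum_schurCoeff_mul_schurMatrix {f : MvPolynomial (Fin n ⊕ Fin m) ℚ}
    (hf : ∀ (σ : Equiv.Perm (Fin n)) (τ : Equiv.Perm (Fin m)), rename (Sum.map σ τ) f = f)
    (F : ∀ (R : Type) [CommRing R] [Algebra ℚ R],
      Matrix (Fin n) (Fin n) R → Matrix (Fin m) (Fin m) R → R)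
    (hF : ∀ (R S : Type) [CommRing R] [Algebra ℚ R] [CommRing S] [Algebra ℚ S] (φ : R →ₐ[ℚ] S)
      (A : Matrix (Fin n) (Fin n) R) (B : Matrix (Fin m) (Fin m) R),
      φ (F R A B) = F S (A.map φ) (B.map φ))
    (h0 : ∀ (g g' : Matrix (Fin n) (Fin n) ℂ) (x : Fin n → ℂ) (h h' : Matrix (Fin m) (Fin m) ℂ)
      (y : Fin m → ℂ), g * g' = 1 → h * h' = 1 →
      F ℂ (g * Matrix.diagonal x * g') (h * Matrix.diagonal y * h') = aeval (Sum.elim x y) f)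
    (A : Matrix (Fin n) (Fin n) ℚ) (B : Matrix (Fin m) (Fin m) ℚ) :
    F ℚ A B = ∑ lm ∈ partitionBox n m (antisymmetrized f).totalDegree,
      schurCoeff f lm * (schurMatrix lm.1 A * schurMatrix lm.2 B) := by
  have key := eq_zero_of_diagonalizable
    (fun R _ _ A B => F R A B - ∑ lm ∈ partitionBox n m (antisymmetrized f).totalDegree,
      algebraMap ℚ R (schurCoeff f lm) * (schurMatrix lm.1 A * schurMatrix lm.2 B)) ?_ ?_ A B
  · simpa [sub_eq_zero] using key
  · intro R S _ _ _ _ φ A B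
    simp only [map_sub, map_sum, map_mul, hF, map_schurMatrix, AlgHom.commutes]
  · intro g g' x h h' y hg hh
    simp only [schurMatrix_conj_diagonal _ hg, schurMatrix_conj_diagonal _ hh,
      h0 g g' x h h' y hg hh]
    rw [sub_eq_zero]
    conv_lhs => rw [eq_sum_schurCoeff hf]
    simp only [map_sum, map_mul, aeval_sumElim_schurX, aeval_sumElim_schurY, algHom_C]

end Transfer

section PrefixSum

variable {n : ℕ}

theorem prefixSum_succ (a : Fin n → ℕ) (i : Fin n) :
    prefixSum a (i + 1) = prefixSum a i + a i := by
  have h : (Finset.univ.filter fun k : Fin n => (k : ℕ) < i + 1) =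
      insert i (Finset.univ.filter fun k : Fin n => (k : ℕ) < i) := by
    ext k
    simp only [Finset.mem_filter, Finset.mem_univ, true_and, Finset.mem_insert, Fin.ext_iff]
    omega
  rw [prefixSum, h, Finset.sum_insert (by simp), add_comm]
  rfl

theorem eq_of_prefixSum_eq {a b : Fin n → ℕ} (h : ∀ r ≤ n, prefixSum a r = prefixSum b r) :
    a = b := by
  funext i
  have h1 := prefixSum_succ a i
  have h2 := prefixSum_succ b i
  have h3 := h (i + 1) i.2
  have h4 := h i i.2.le
  omega

theorem prefixSum_add (a b : Fin n → ℕ) (r : ℕ) :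
    prefixSum (a + b) r = prefixSum a r + prefixSum b r := by
  simp [prefixSum, Finset.sum_add_distrib]

theorem prefixSum_staircase_comp_le (σ : Equiv.Perm (Fin n)) (r : ℕ) :
    prefixSum (staircase n ∘ σ) r ≤ prefixSum (staircase n) r := by
  have h := sum_filter_lt_le_sum_perm σ r
  have hcast : ∀ i : Fin n, (staircase n i : ℤ) = (n : ℤ) - 1 - (i : ℕ) := by
    intro i
    have := i.2
    simp only [staircase]
    omega
  have h2 : (prefixSum (staircase n ∘ σ) r : ℤ) ≤ prefixSum (staircase n) r := by
    simp only [prefixSum, Nat.cast_sum, Function.comp_apply, hcast, Finset.sum_sub_distrib]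
    linarith
  exact_mod_cast h2

/-- The number of cells carrying each label. -/
def content {ι : Type*} [Fintype ι] (w : ι → Fin n) (i : Fin n) : ℕ :=
  (Finset.univ.filter fun c => w c = i).card

theorem prefixSum_content {ι : Type*} [Fintype ι] (w : ι → Fin n) (r : ℕ) :
    prefixSum (content w) r = (Finset.univ.filter fun c => (w c : ℕ) < r).card := by
  rw [prefixSum, Finset.card_eq_sum_card_fiberwise (f := w)
    (t := Finset.univ.filter fun i : Fin n => (i : ℕ) < r) (fun c hc => by simpa using hc)]
  refine Finset.sum_congr rfl fun i hi => ?_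
  rw [content, Finset.filter_filter]
  congr 1
  ext c
  simp only [Finset.mem_filter, Finset.mem_univ, true_and] at hi ⊢
  exact ⟨fun h => ⟨h ▸ hi, h⟩, fun h => h.2⟩

theorem sum_content {ι : Type*} [Fintype ι] (w : ι → Fin n) :
    ∑ i, content w i = Fintype.card ι := by
  have := Finset.card_eq_sum_card_fiberwise (f := w) (s := Finset.univ) (t := Finset.univ)
    (fun c _ => by simp)
  rw [← Finset.card_univ, this]
  rfl

end PrefixSum

section ColPoly

variable {n : ℕ}

/-- The labellings of the cells that are injective on columns. -/
def colInjective (mu : Fin n → ℕ) : Finset (Cell mu → Fin n) :=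
  open scoped Classical in
  Finset.univ.filter fun w => ∀ c d : Cell mu, c.col = d.col → w c = w d → c = d

theorem mem_colInjective {mu : Fin n → ℕ} {w : Cell mu → Fin n} :
    w ∈ colInjective mu ↔ ∀ c d : Cell mu, c.col = d.col → w c = w d → c = d := by
  simp [colInjective]

/-- The product of elementary symmetric polynomials of degrees the column lengths, up to a
scalar. -/
noncomputable def colPoly (mu : Fin n → ℕ) : MvPolynomial (Fin n ⊕ Fin 0) ℚ :=
  ∑ w ∈ colInjective mu, ∏ c, X (Sum.inl (w c))

theorem rename_colPoly (mu : Fin n → ℕ) (σ : Equiv.Perm (Fin n)) (τ : Equiv.Perm (Fin 0)) :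
    rename (Sum.map σ τ) (colPoly mu) = colPoly mu := by
  simp only [colPoly, map_sum, map_prod, rename_X, Sum.map_inl]
  refine Finset.sum_equiv ((Equiv.refl _).arrowCongr σ) (fun w => ?_) (fun w _ => rfl)
  simp [mem_colInjective]

theorem colPoly_eq_sum_monomial (mu : Fin n → ℕ) :
    colPoly mu = ∑ w ∈ colInjective mu, monomial (pairExp (content w) 0) 1 := by
  refine Finset.sum_congr rfl fun w _ => ?_
  rw [monomial_pairExp, ← Finset.prod_fiberwise (g := w)]
  simp only [Finset.univ_eq_empty, Finset.prod_empty, mul_one]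
  refine Finset.prod_congr rfl fun i _ => ?_
  rw [Finset.prod_congr rfl fun c hc => by rw [(Finset.mem_filter.mp hc).2], Finset.prod_const]
  rfl

theorem sum_sign_stabilizer (mu : Fin n → ℕ) (w : Cell mu → Fin n) :
    ∑ σ ∈ colPerms mu, ((σ.sign : ℤ) : ℚ) * (if w ∘ σ = w then 1 else 0) =
      if w ∈ colInjective mu then 1 else 0 := by
  split_ifs with h
  · rw [mem_colInjective] at h
    rw [Finset.sum_eq_single_of_mem 1 one_mem_colPerms]
    · simp
    · intro σ hσ hne
      rw [if_neg, mul_zero]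
      intro hw
      exact hne (Equiv.ext fun c => h _ _ ((Finset.mem_filter.mp hσ).2 c) (congrFun hw c))
  · rw [mem_colInjective] at h
    push Not at h
    obtain ⟨c, d, hcol, hrow, hcd⟩ := h
    refine sum_sign_mul_eq_zero hcd hcol _ fun σ => ?_
    have hs : w ∘ Equiv.swap c d = w := by
      funext x
      rw [Function.comp_apply, Equiv.swap_apply_def]
      split_ifs with h1 h2
      · rw [h1, hrow]
      · rw [h2, hrow]
      · rfl
    rw [Equiv.Perm.coe_mul, ← Function.comp_assoc, hs]

theorem colTrace_conj_diagonal {R : Type*} [CommRing R] [Algebra ℚ R] (mu : Fin n → ℕ)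
    {g g' : Matrix (Fin n) (Fin n) R} (h : g * g' = 1) (x : Fin n → R) (y : Fin 0 → R) :
    colTrace mu (g * Matrix.diagonal x * g') = aeval (Sum.elim x y) (colPoly mu) := by
  simp only [colTrace, permTrace_conj _ h, permTrace_diagonal, Finset.mul_sum]
  rw [Finset.sum_comm]
  simp only [colPoly, map_sum, map_prod, aeval_X, Sum.elim_inl]
  have hw : ∀ w : Cell mu → Fin n, ∑ σ ∈ colPerms mu,
      ((σ.sign : ℤ) : R) * (if w ∘ σ = w then ∏ c, x (w c) else 0) =
      if w ∈ colInjective mu then ∏ c, x (w c) else 0 := by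
    intro w
    have hs := congrArg (fun q => algebraMap ℚ R q * ∏ c, x (w c)) (sum_sign_stabilizer mu w)
    simp only [map_sum, map_mul, map_intCast, Finset.sum_mul, apply_ite (algebraMap ℚ R), map_one,
      map_zero, mul_assoc, ite_mul, one_mul, zero_mul] at hs
    exact hs
  rw [Finset.sum_congr rfl fun w _ => hw w, Finset.sum_ite_mem, Finset.univ_inter]

theorem map_colTrace {R S : Type*} [CommRing R] [Algebra ℚ R] [CommRing S] [Algebra ℚ S]
    (φ : R →ₐ[ℚ] S) (mu : Fin n → ℕ) (A : Matrix (Fin n) (Fin n) R) :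
    φ (colTrace mu A) = colTrace mu (A.map φ) := by
  simp only [colTrace, map_sum, map_mul, map_intCast, map_permTrace]

theorem schurCoeff_colPoly (mu : Fin n → ℕ) (lm : (Fin n → ℕ) × (Fin 0 → ℕ)) :
    schurCoeff (colPoly mu) lm = ∑ w ∈ colInjective mu, ∑ σ : Equiv.Perm (Fin n),
      if content w + staircase n ∘ σ = lm.1 + staircase n then ((σ.sign : ℤ) : ℚ) else 0 := by
  rw [schurCoeff, antisymmetrized, colPoly_eq_sum_monomial, rename_alternant_mul,
    Finset.sum_mul_sum, coeff_sum]
  refine Finset.sum_congr rfl fun w _ => ?_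
  rw [coeff_sum]
  refine Finset.sum_congr rfl fun σ _ => ?_
  have hadd : ∀ τ : Equiv.Perm (Fin 0), pairExp (content w) 0 +
      pairExp (staircase n ∘ σ) (staircase 0 ∘ τ) =
      pairExp (content w + staircase n ∘ σ) (lm.2 + staircase 0) := by
    intro τ
    ext i
    rcases i with i | i
    · simp [pairExp]
    · exact i.elim0
  rw [Fintype.sum_unique, monomial_mul, hadd, coeff_monomial]
  simp [pairExp_inj]

end ColPoly

section Triangularity

variable {n : ℕ}

theorem prefixSum_le_of_content_add {mu nu : Fin n → ℕ} (hmu : Antitone mu)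
    {w : Cell mu → Fin n} (hw : w ∈ colInjective mu) {σ : Equiv.Perm (Fin n)}
    (h : content w + staircase n ∘ σ = nu + staircase n) (r : ℕ) :
    prefixSum nu r + prefixSum (staircase n) r ≤
      prefixSum mu r + prefixSum (staircase n ∘ σ) r := by
  have h1 := congrArg (fun a => prefixSum a r) h
  simp only [prefixSum_add] at h1
  have h2 := card_label_lt_le hmu w (mem_colInjective.mp hw) r
  rw [← prefixSum_content] at h2
  omega

theorem schurCoeff_colPoly_ne_zero {mu : Fin n → ℕ} (hmu : Antitone mu)
    {lm : (Fin n → ℕ) × (Fin 0 → ℕ)} (h : schurCoeff (colPoly mu) lm ≠ 0) :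
    ∑ i, lm.1 i = ∑ i, mu i ∧ ∀ r, prefixSum lm.1 r ≤ prefixSum mu r := by
  rw [schurCoeff_colPoly] at h
  obtain ⟨w, hw, h⟩ := Finset.exists_ne_zero_of_sum_ne_zero h
  obtain ⟨σ, -, h⟩ := Finset.exists_ne_zero_of_sum_ne_zero h
  have heq : content w + staircase n ∘ σ = lm.1 + staircase n := by
    by_contra hne
    exact h (if_neg hne)
  constructor
  · have h1 := congrArg (fun a : Fin n → ℕ => ∑ i, a i) heq
    simp only [Pi.add_apply, Finset.sum_add_distrib, Function.comp_apply, sum_content,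
      card_cell, Equiv.sum_comp σ (staircase n)] at h1
    omega
  · intro r
    have h1 := prefixSum_le_of_content_add hmu hw heq r
    have h2 := prefixSum_staircase_comp_le σ r
    omega

theorem staircase_injective : Function.Injective (staircase n) := by
  intro i j h
  have := i.2
  have := j.2
  simp only [staircase] at h
  exact Fin.ext (by omega)

theorem content_fst (mu : Fin n → ℕ) : content (fun c : Cell mu => c.1) = mu := by
  refine eq_of_prefixSum_eq fun r _ => ?_
  rw [prefixSum_content, prefixSum_eq_card]

theorem schurCoeff_colPoly_self_pos {mu : Fin n → ℕ} (hmu : Antitone mu) (b : Fin 0 → ℕ) :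
    0 < schurCoeff (colPoly mu) (mu, b) := by
  rw [schurCoeff_colPoly]
  have hterm : ∀ w ∈ colInjective mu, ∀ σ : Equiv.Perm (Fin n),
      content w + staircase n ∘ σ = mu + staircase n → σ = 1 := by
    intro w hw σ h
    have hst : staircase n ∘ σ = staircase n := by
      refine eq_of_prefixSum_eq fun r _ => le_antisymm (prefixSum_staircase_comp_le σ r) ?_
      have := prefixSum_le_of_content_add hmu hw h r
      omega
    exact Equiv.ext fun i => staircase_injective (congrFun hst i)
  have hnonneg : ∀ w ∈ colInjective mu, ∀ σ : Equiv.Perm (Fin n),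
      0 ≤ if content w + staircase n ∘ σ = mu + staircase n then ((σ.sign : ℤ) : ℚ) else 0 := by
    intro w hw σ
    split_ifs with h
    · simp [hterm w hw σ h]
    · exact le_rfl
  refine Finset.sum_pos' (fun w hw => Finset.sum_nonneg fun σ _ => hnonneg w hw σ)
    ⟨fun c => c.1, ?_, ?_⟩
  · exact mem_colInjective.mpr fun c d hcol hrow => Cell.ext' hrow hcol
  · refine Finset.sum_pos' (fun σ _ => hnonneg _ ?_ σ) ⟨1, Finset.mem_univ _, ?_⟩
    · exact mem_colInjective.mpr fun c d hcol hrow => Cell.ext' hrow hcol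
    · rw [content_fst]
      simp

theorem colTrace_eq_sum_schurMatrix (mu : Fin n → ℕ) (A : Matrix (Fin n) (Fin n) ℚ) :
    colTrace mu A = ∑ lm ∈ partitionBox n 0 (antisymmetrized (colPoly mu)).totalDegree,
      schurCoeff (colPoly mu) lm * schurMatrix lm.1 A := by
  have h := eq_sum_schurCoeff_mul_schurMatrix (rename_colPoly mu) (fun R _ _ A _ => colTrace mu A)
    (fun R S _ _ _ _ φ A _ => map_colTrace φ mu A)
    (fun g g' x _ _ y hg _ => colTrace_conj_diagonal mu hg x y) A 0
  rw [h]
  refine Finset.sum_congr rfl fun lm _ => ?_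
  rw [show schurMatrix lm.2 (0 : Matrix (Fin 0) (Fin 0) ℚ) = 1 from Matrix.det_fin_zero, mul_one]

theorem cellFunctional_colTrace_eq_sum (lam mu : Fin n → ℕ) :
    cellFunctional lam (colTrace mu) =
      ∑ lm ∈ partitionBox n 0 (antisymmetrized (colPoly mu)).totalDegree,
        schurCoeff (colPoly mu) lm * cellFunctional lam (schurMatrix lm.1) := by
  have h : (colTrace mu : Matrix (Fin n) (Fin n) ℚ → ℚ) = fun A => ∑ lm ∈
      partitionBox n 0 (antisymmetrized (colPoly mu)).totalDegree,
        schurCoeff (colPoly mu) lm * schurMatrix lm.1 A :=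
    funext fun A => colTrace_eq_sum_schurMatrix mu A
  rw [h, cellFunctional_sum]
  exact Finset.sum_congr rfl fun lm _ => cellFunctional_smul lam _ _

theorem self_mem_partitionBox_colPoly {mu : Fin n → ℕ} (hmu : Antitone mu) :
    (mu, (0 : Fin 0 → ℕ)) ∈ partitionBox n 0 (antisymmetrized (colPoly mu)).totalDegree := by
  have hpos := schurCoeff_colPoly_self_pos hmu 0
  have hmem := le_totalDegree (mem_support_iff.mpr hpos.ne')
  refine mem_partitionBox.mpr ⟨⟨fun i => ?_, fun i => i.elim0⟩, hmu, fun i => i.elim0⟩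
  refine le_trans ?_ hmem
  rw [Finsupp.sum_fintype _ _ (by simp)]
  refine le_trans ?_ (Finset.single_le_sum (fun _ _ => Nat.zero_le _) (Finset.mem_univ (Sum.inl i)))
  simp [pairExp]

/-- The functional of a diagram detects only Schur functions of partitions dominating it. -/
theorem cellFunctional_schurMatrix_eq_zero_of_not_le {lam : Fin n → ℕ} {mu : Fin n → ℕ}
    (hmu : Antitone mu) (hcard : ∑ i, mu i = ∑ i, lam i)
    (hnot : ¬ ∀ r, prefixSum lam r ≤ prefixSum mu r) :
    cellFunctional lam (schurMatrix mu) = 0 := by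
  induction hN : ∑ r ∈ Finset.range (n + 1), prefixSum mu r using Nat.strong_induction_on
    generalizing mu with
  | _ N ih =>
    have h0 : cellFunctional lam (colTrace mu) = 0 := by
      by_contra hne
      exact hnot (prefixSum_le_of_cellFunctional_colTrace_ne_zero hmu hcard hne)
    rw [cellFunctional_colTrace_eq_sum,
      Finset.sum_eq_single_of_mem _ (self_mem_partitionBox_colPoly hmu)] at h0
    · exact (mul_eq_zero.mp h0).resolve_left (schurCoeff_colPoly_self_pos hmu 0).ne'
    · intro lm hlm hne
      by_cases hc : schurCoeff (colPoly mu) lm = 0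
      · rw [hc, zero_mul]
      obtain ⟨hs, hp⟩ := schurCoeff_colPoly_ne_zero hmu hc
      rw [ih _ ?_ (mem_partitionBox.mp hlm).2.1 (hs.trans hcard)
        (fun h => hnot fun r => (h r).trans (hp r)) rfl, mul_zero]
      rw [← hN]
      refine Finset.sum_lt_sum (fun r _ => hp r) ?_
      by_contra hlt
      push Not at hlt
      refine hne (Prod.ext (eq_of_prefixSum_eq fun r hr => ?_) (Subsingleton.elim _ _))
      exact le_antisymm (hp r) (hlt r (Finset.mem_range.mpr (Nat.lt_succ_of_le hr)))

/-- The functional of a diagram is orthogonal to the other Schur functions of at most its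
degree. -/
theorem cellFunctional_schurMatrix_eq_zero {lam nu : Fin n → ℕ} (hlam : Antitone lam)
    (hnu : Antitone nu) (hle : ∑ i, nu i ≤ ∑ i, lam i) (hne : nu ≠ lam) :
    cellFunctional lam (schurMatrix nu) = 0 := by
  by_contra h
  obtain ⟨h1, h2⟩ := prefixSum_le_of_cellFunctional_schurMatrix_ne_zero hlam hle h
  refine h (cellFunctional_schurMatrix_eq_zero_of_not_le hnu h1 fun h3 => hne ?_)
  exact eq_of_prefixSum_eq fun r _ => le_antisymm (h2 r) (h3 r)

theorem cellFunctional_schurMatrix_self_pos {lam : Fin n → ℕ} (hlam : Antitone lam) :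
    0 < cellFunctional lam (schurMatrix lam) := by
  have h := cellFunctional_colTrace_self_pos lam
  rw [cellFunctional_colTrace_eq_sum,
      Finset.sum_eq_single_of_mem _ (self_mem_partitionBox_colPoly hlam)] at h
  · exact (pos_iff_pos_of_mul_pos h).mp (schurCoeff_colPoly_self_pos hlam 0)
  · intro lm hlm hne
    by_cases hc : schurCoeff (colPoly lam) lm = 0
    · rw [hc, zero_mul]
    rw [cellFunctional_schurMatrix_eq_zero hlam (mem_partitionBox.mp hlm).2.1
      (schurCoeff_colPoly_ne_zero hlam hc).1.le, mul_zero]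
    exact fun h => hne (Prod.ext h (Subsingleton.elim _ _))

end Triangularity

section Coefficients

variable {n m : ℕ}

theorem rename_P (j k : ℕ) (σ : Equiv.Perm (Fin n)) (τ : Equiv.Perm (Fin m)) :
    rename (Sum.map σ τ) (P n m j k) = P n m j k := by
  simp only [P, map_prod, map_add, map_sum, rename_X, Sum.map_inl, Sum.map_inr]
  refine Finset.prod_equiv σ.finsetCongr (fun S => by simp [Finset.mem_powersetCard]) fun S _ => ?_
  refine Finset.prod_equiv τ.finsetCongr (fun T => by simp [Finset.mem_powersetCard]) fun T _ => ?_
  simp [Equiv.finsetCongr_apply, Finset.sum_map]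

theorem isHomogeneous_P (n m j k : ℕ) : (P n m j k).IsHomogeneous (n.choose j * m.choose k) := by
  have h : ∀ S ∈ (Finset.univ : Finset (Fin n)).powersetCard j,
      (∏ T ∈ (Finset.univ : Finset (Fin m)).powersetCard k, ((∑ i ∈ S, X (Sum.inl i)) +
        ∑ i ∈ T, X (Sum.inr i) : MvPolynomial (Fin n ⊕ Fin m) ℚ)).IsHomogeneous (m.choose k) := by
    intro S _
    have := IsHomogeneous.prod ((Finset.univ : Finset (Fin m)).powersetCard k)
      (fun T => ((∑ i ∈ S, X (Sum.inl i)) + ∑ i ∈ T, X (Sum.inr i) :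
        MvPolynomial (Fin n ⊕ Fin m) ℚ)) (fun _ => 1) fun T _ =>
      (IsHomogeneous.sum _ _ _ fun i _ => isHomogeneous_X _ _).add
        (IsHomogeneous.sum _ _ _ fun i _ => isHomogeneous_X _ _)
    simpa using this
  have := IsHomogeneous.prod _ _ _ h
  simpa [P] using this

theorem degree_pairExp (α : Fin n → ℕ) (β : Fin m → ℕ) :
    (pairExp α β).degree = ∑ i, α i + ∑ i, β i := by
  rw [Finsupp.degree_eq_sum]
  simp [pairExp]

theorem sum_eq_of_schurCoeff_ne_zero {f : MvPolynomial (Fin n ⊕ Fin m) ℚ} {d : ℕ}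
    (hf : f.IsHomogeneous d) {lm : (Fin n → ℕ) × (Fin m → ℕ)} (h : schurCoeff f lm ≠ 0) :
    ∑ i, lm.1 i + ∑ i, lm.2 i = d := by
  have halt : (rename Sum.inl (alternant n (staircase n)) *
      rename Sum.inr (alternant m (staircase m)) : MvPolynomial (Fin n ⊕ Fin m) ℚ).IsHomogeneous
        (∑ i, staircase n i + ∑ i, staircase m i) := by
    rw [rename_alternant_mul]
    refine IsHomogeneous.sum _ _ _ fun σ _ => IsHomogeneous.sum _ _ _ fun τ _ =>
      isHomogeneous_monomial _ ?_
    rw [degree_pairExp]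
    simp only [Function.comp_apply, Equiv.sum_comp σ (staircase n), Equiv.sum_comp τ (staircase m)]
  have hdeg : (pairExp (lm.1 + staircase n) (lm.2 + staircase m)).degree =
      d + (∑ i, staircase n i + ∑ i, staircase m i) := by
    by_contra hne
    exact h ((hf.mul halt).coeff_eq_zero hne)
  rw [degree_pairExp] at hdeg
  simp only [Pi.add_apply, Finset.sum_add_distrib] at hdeg
  omega

theorem exists_int_eq_schurCoeff_P (j k : ℕ) (lm : (Fin n → ℕ) × (Fin m → ℕ)) :
    ∃ z : ℤ, schurCoeff (P n m j k) lm = z := by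
  set S := (map (σ := Fin n ⊕ Fin m) (Int.castRingHom ℚ)).range with hS
  have hX : ∀ i, (X i : MvPolynomial (Fin n ⊕ Fin m) ℚ) ∈ S := fun i => ⟨X i, map_X _ _⟩
  have hP : P n m j k ∈ S := Subring.prod_mem _ fun T _ => Subring.prod_mem _ fun T' _ =>
    Subring.add_mem _ (Subring.sum_mem _ fun i _ => hX _) (Subring.sum_mem _ fun i _ => hX _)
  have halt : rename Sum.inl (alternant n (staircase n)) *
      rename Sum.inr (alternant m (staircase m)) ∈ S := by
    rw [rename_alternant_mul]
    refine Subring.sum_mem _ fun σ _ => Subring.sum_mem _ fun τ _ => ?_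
    exact ⟨monomial (pairExp (staircase n ∘ σ) (staircase m ∘ τ)) ((σ.sign : ℤ) * (τ.sign : ℤ)),
      by simp [map_monomial]⟩
  obtain ⟨g, hg⟩ := Subring.mul_mem _ hP halt
  refine ⟨coeff (pairExp (lm.1 + staircase n) (lm.2 + staircase m)) g, ?_⟩
  rw [schurCoeff, antisymmetrized, ← hg]
  exact coeff_map _ _ _

theorem sum_prod_functional {Ω Ω' : Type*} [Fintype Ω] [Fintype Ω'] (f : Ω → Ω → ℚ)
    (g : Ω' → Ω' → ℚ) :
    ∑ a : Ω × Ω', ∑ b : Ω × Ω', f a.1 b.1 * g a.2 b.2 =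
      (∑ a, ∑ b, f a b) * ∑ a, ∑ b, g a b := by
  simp only [Fintype.sum_prod_type, ← Finset.mul_sum, ← Finset.sum_mul]

theorem schurCoeff_P_nonneg {j k : ℕ} (hn : n ≠ 0) (hm : m ≠ 0)
    {lm : (Fin n → ℕ) × (Fin m → ℕ)}
    (hlm : lm ∈ partitionBox n m (antisymmetrized (P n m j k)).totalDegree) :
    0 ≤ schurCoeff (P n m j k) lm := by
  by_cases hzero : schurCoeff (P n m j k) lm = 0
  · exact hzero.ge
  have hpart := (mem_partitionBox.mp hlm).2
  have hdeg := sum_eq_of_schurCoeff_ne_zero (isHomogeneous_P n m j k) hzero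
  have hnonneg := sum_mul_det_mixedCompound_nonneg hn hm j k
    (fun a : SignedColPerm lm.1 × SignedColPerm lm.2 => signWeight lm.1 a.1 * signWeight lm.2 a.2)
    (fun a => signMatrix lm.1 a.1) (fun a => signMatrix lm.2 a.2)
  have hexp : ∀ A B, (mixedCompound j k A B).det =
      ∑ nr ∈ partitionBox n m (antisymmetrized (P n m j k)).totalDegree,
        schurCoeff (P n m j k) nr * (schurMatrix nr.1 A * schurMatrix nr.2 B) :=
    eq_sum_schurCoeff_mul_schurMatrix (rename_P j k)
      (fun R _ _ A B => (mixedCompound j k A B).det)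
      (fun R S _ _ _ _ φ A B => map_det_mixedCompound φ j k A B)
      (fun g g' x h h' y hg hh => det_mixedCompound_conj_diagonal j k hg hh x y)
  have hfactor : ∑ a : SignedColPerm lm.1 × SignedColPerm lm.2,
      ∑ b : SignedColPerm lm.1 × SignedColPerm lm.2,
        signWeight lm.1 a.1 * signWeight lm.2 a.2 * (signWeight lm.1 b.1 * signWeight lm.2 b.2) *
          (mixedCompound j k ((signMatrix lm.1 a.1).transpose * signMatrix lm.1 b.1)
            ((signMatrix lm.2 a.2).transpose * signMatrix lm.2 b.2)).det =
      ∑ nr ∈ partitionBox n m (antisymmetrized (P n m j k)).totalDegree,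
        schurCoeff (P n m j k) nr *
          (cellFunctional lm.1 (schurMatrix nr.1) * cellFunctional lm.2 (schurMatrix nr.2)) := by
    simp only [hexp, Finset.mul_sum]
    refine ((Finset.sum_congr rfl fun a _ => Finset.sum_comm).trans Finset.sum_comm).trans ?_
    refine Finset.sum_congr rfl fun nr _ => ?_
    rw [cellFunctional, cellFunctional, ← sum_prod_functional, Finset.mul_sum]
    refine Finset.sum_congr rfl fun a _ => ?_
    rw [Finset.mul_sum]
    refine Finset.sum_congr rfl fun b _ => ?_
    ring
  rw [hfactor, Finset.sum_eq_single_of_mem lm hlm] at hnonneg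
  · exact nonneg_of_mul_nonneg_left hnonneg (mul_pos
      (cellFunctional_schurMatrix_self_pos hpart.1) (cellFunctional_schurMatrix_self_pos hpart.2))
  · intro nr hnr hne
    by_cases hc : schurCoeff (P n m j k) nr = 0
    · rw [hc, zero_mul]
    have hdeg' := sum_eq_of_schurCoeff_ne_zero (isHomogeneous_P n m j k) hc
    have hpart' := (mem_partitionBox.mp hnr).2
    have hcases : (∑ i, nr.1 i ≤ ∑ i, lm.1 i ∧ nr.1 ≠ lm.1) ∨
        (∑ i, nr.2 i ≤ ∑ i, lm.2 i ∧ nr.2 ≠ lm.2) := by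
      by_cases h1 : nr.1 = lm.1
      · refine Or.inr ⟨?_, fun h2 => hne (Prod.ext h1 h2)⟩
        rw [h1] at hdeg'
        omega
      · by_cases h2 : ∑ i, nr.1 i ≤ ∑ i, lm.1 i
        · exact Or.inl ⟨h2, h1⟩
        · refine Or.inr ⟨by omega, fun h3 => ?_⟩
          rw [h3] at hdeg'
          omega
    rcases hcases with ⟨h1, h2⟩ | ⟨h1, h2⟩
    · rw [cellFunctional_schurMatrix_eq_zero hpart.1 hpart'.1 h1 h2, zero_mul, mul_zero]
    · rw [cellFunctional_schurMatrix_eq_zero hpart.2 hpart'.2 h1 h2, mul_zero, mul_zero]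

end Coefficients

theorem stmt12 (n m j k : ℕ) (hj : 1 ≤ j) (hjn : j ≤ n) (hk : 1 ≤ k) (hkm : k ≤ m) :
    ∃ (Q : Finset ((Fin n → ℕ) × (Fin m → ℕ)))
      (a : (Fin n → ℕ) × (Fin m → ℕ) → ℕ),
      (∀ lm ∈ Q, Antitone lm.1 ∧ Antitone lm.2) ∧
      P n m j k = ∑ lm ∈ Q,
        (a lm : MvPolynomial (Fin n ⊕ Fin m) ℚ) * schurX n m lm.1 * schurY n m lm.2 := by
  refine ⟨partitionBox n m (antisymmetrized (P n m j k)).totalDegree,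
    fun lm => (schurCoeff (P n m j k) lm).num.toNat,
    fun lm hlm => (mem_partitionBox.mp hlm).2, ?_⟩
  conv_lhs => rw [eq_sum_schurCoeff (rename_P j k)]
  refine Finset.sum_congr rfl fun lm hlm => ?_
  have hnonneg := schurCoeff_P_nonneg (by omega) (by omega) hlm
  obtain ⟨z, hz⟩ := exists_int_eq_schurCoeff_P j k lm
  rw [hz] at hnonneg
  lift z to ℕ using Int.cast_nonneg_iff.mp hnonneg
  have ha : (schurCoeff (P n m j k) lm).num.toNat = z := by
    rw [hz]
    simp
  beta_reduce
  rw [ha, hz, mul_assoc]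
  simp
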